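/- Let K be a number field of degree 6 over ℚ that is Galois over ℚ with cyclic Galois group, and suppose K contains elements α and β with α³ = 93α − 124 and β² = −1 (so K is the sextic cyclic CM field ℚ(α, i) of conductor 124, with class number 4 and whose cubic subfield has class number 1). Then there exist a generator σ of Gal(K/ℚ), a nonzero ideal 𝔠 of 𝒪_K, and a Shimura ideal character of type (σ, 𝔠). -/

import Mathlib

open NumberField

/-- The action of `τ ∈ Gal(K/ℚ)` on ideals of the ring of integers of `K`,
via the restriction of `τ` to `𝓞 K`. -/
noncomputable def idealConj {K : Type*} [Field K] [NumberField K] (τ : K ≃ₐ[ℚ] K)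
    (I : Ideal (𝓞 K)) : Ideal (𝓞 K) :=
  Ideal.map (galRestrict ℤ ℚ K (𝓞 K) τ) I

/-- The cubic subfield `F` of `K`: the fixed field of `ρ = σ³`. -/
noncomputable def cubicFixedField {K : Type*} [Field K] [NumberField K] (σ : K ≃ₐ[ℚ] K) :
    IntermediateField ℚ K :=
  IntermediateField.fixedField (Subgroup.zpowers (σ ^ 3))

/-- A *Shimura ideal character of type `(σ, 𝔠)`* on a sextic cyclic CM field `K` with
`σ` a generator of `Gal(K/ℚ)`, `ρ = σ³`, and `F` the cubic subfield (fixed field of `ρ`):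
a map `ψ` from the nonzero ideals of `𝓞 K` coprime to `𝔠` to the nonzero elements of `K`
such that
(i)   `ψ (I * J) = ψ I * ψ J`;
(ii)  `ψ (s 𝓞 K) = s • σ⁴ s • σ⁵ s` whenever `s ≡ 1 mod 𝔠`;
(iii) for a prime `𝔭` of `𝓞 F` unramified in `K` (coprime to `𝔠`), `ψ (𝔭 𝓞 K) = N 𝔭`
      if `𝔭` splits in `K` and `ψ (𝔭 𝓞 K) = -N 𝔭` if `𝔭 𝓞 K` is prime;
(iv)  `ψ I * ρ (ψ I) = N I` and `ψ I • 𝓞 K = I • σ⁴ I • σ⁵ I` as (fractional) ideals;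
(v)   `ψ (σ I) = σ (ψ I)`.
Here the absolute norm `N` of an ideal is the cardinality of the corresponding quotient. -/
noncomputable def IsShimuraIdealChar {K : Type*} [Field K] [NumberField K]
    (σ : K ≃ₐ[ℚ] K) (𝔠 : Ideal (𝓞 K)) (ψ : Ideal (𝓞 K) → K) : Prop :=
  -- ψ takes nonzero values on nonzero ideals coprime to 𝔠
  (∀ I : Ideal (𝓞 K), I ≠ ⊥ → IsCoprime I 𝔠 → ψ I ≠ 0) ∧
  -- (i) multiplicativity
  (∀ I J : Ideal (𝓞 K), I ≠ ⊥ → J ≠ ⊥ → IsCoprime I 𝔠 → IsCoprime J 𝔠 →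
    ψ (I * J) = ψ I * ψ J) ∧
  -- (ii) value on principal ideals generated by `s ≡ 1 mod 𝔠`
  (∀ s : 𝓞 K, IsCoprime (Ideal.span {s}) 𝔠 → s - 1 ∈ 𝔠 →
    ψ (Ideal.span {s}) = (s : K) * (σ ^ 4) (s : K) * (σ ^ 5) (s : K)) ∧
  -- (iii) value on primes of the cubic subfield `F` unramified in `K`: such a prime either
  -- splits (`𝔭 𝓞 K` is a product of two distinct primes) or is inert (`𝔭 𝓞 K` is prime)
  (∀ 𝔭 : Ideal (𝓞 (cubicFixedField σ)), 𝔭.IsPrime → 𝔭 ≠ ⊥ →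
    IsCoprime (Ideal.map (algebraMap (𝓞 (cubicFixedField σ)) (𝓞 K)) 𝔭) 𝔠 →
    ((∃ Q₁ Q₂ : Ideal (𝓞 K), Q₁.IsPrime ∧ Q₂.IsPrime ∧ Q₁ ≠ Q₂ ∧
        Ideal.map (algebraMap (𝓞 (cubicFixedField σ)) (𝓞 K)) 𝔭 = Q₁ * Q₂) →
      ψ (Ideal.map (algebraMap (𝓞 (cubicFixedField σ)) (𝓞 K)) 𝔭)
        = (Nat.card (𝓞 (cubicFixedField σ) ⧸ 𝔭) : K)) ∧
    ((Ideal.map (algebraMap (𝓞 (cubicFixedField σ)) (𝓞 K)) 𝔭).IsPrime →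
      ψ (Ideal.map (algebraMap (𝓞 (cubicFixedField σ)) (𝓞 K)) 𝔭)
        = -(Nat.card (𝓞 (cubicFixedField σ) ⧸ 𝔭) : K))) ∧
  -- (iv) norm relation and ideal generation
  (∀ I : Ideal (𝓞 K), I ≠ ⊥ → IsCoprime I 𝔠 →
    ψ I * (σ ^ 3) (ψ I) = (Nat.card (𝓞 K ⧸ I) : K) ∧
    FractionalIdeal.spanSingleton (nonZeroDivisors (𝓞 K)) (ψ I)
      = ((I * idealConj (σ ^ 4) I * idealConj (σ ^ 5) I : Ideal (𝓞 K)) :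
          FractionalIdeal (nonZeroDivisors (𝓞 K)) K)) ∧
  -- (v) Galois equivariance with respect to σ
  (∀ I : Ideal (𝓞 K), I ≠ ⊥ → IsCoprime I 𝔠 → ψ (idealConj σ I) = σ (ψ I))


/-- The concrete data used in the proof, on the ring of integers. -/
structure ShSetup (K : Type*) [Field K] [NumberField K] (σ : K ≃ₐ[ℚ] K) (s : 𝓞 K ≃ₐ[ℤ] 𝓞 K)
    (b e0 e1 e2 : 𝓞 K) : Prop where
  rank : Module.finrank ℚ K = 6
  hs : ∀ x : 𝓞 K, ((s x : 𝓞 K) : K) = σ (x : K)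
  gen : ∀ τ : K ≃ₐ[ℚ] K, τ ∈ Subgroup.zpowers σ
  ord : orderOf σ = 6
  s6 : ∀ x : 𝓞 K, s (s (s (s (s (s x))))) = x
  bb : b * b = -1
  sb : s b = -b
  s0 : s e0 = e1
  s1 : s e1 = e2
  s2 : s e2 = e0
  sum : e0 + e1 + e2 = -1
  m00 : e0 * e0 = -7 * e0 - 6 * e1 - 8 * e2
  m11 : e1 * e1 = -8 * e0 - 7 * e1 - 6 * e2
  m22 : e2 * e2 = -6 * e0 - 8 * e1 - 7 * e2
  m01 : e0 * e1 = 4 * e0 + 2 * e1 + 4 * e2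
  m12 : e1 * e2 = 4 * e0 + 4 * e1 + 2 * e2
  m02 : e0 * e2 = 2 * e0 + 4 * e1 + 4 * e2
  conj : ∀ (φ : K →+* ℂ) (x : K), φ ((σ ^ 3) x) = (starRingEnd ℂ) (φ x)
  fix2 : ∀ x : 𝓞 K, s (s x) = x → ∃ m n : ℤ, x = m + n * b

lemma sh_fixed_rat {K : Type*} [Field K] [NumberField K] [IsGalois ℚ K] (σ : K ≃ₐ[ℚ] K)
    (gen : ∀ τ : K ≃ₐ[ℚ] K, τ ∈ Subgroup.zpowers σ) (x : K) (hx : σ x = x) :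
    ∃ q : ℚ, algebraMap ℚ K q = x := by
  have : x ∈ (⊥ : IntermediateField ℚ K) := by
    rw [IsGalois.mem_bot_iff_fixed]
    intro τ
    have h : σ ∈ MulAction.stabilizer (K ≃ₐ[ℚ] K) x := by
      rw [MulAction.mem_stabilizer_iff]; exact hx
    have h2 := (Subgroup.zpowers_le.mpr h) (gen τ)
    exact MulAction.mem_stabilizer_iff.mp h2
  exact IntermediateField.mem_bot.mp this

lemma sh_rat_int {K : Type*} [Field K] [NumberField K] (q : ℚ)
    (hq : IsIntegral ℤ (algebraMap ℚ K q)) : ∃ n : ℤ, (n : ℚ) = q := by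
  have h : IsIntegral ℤ q := (isIntegral_algebraMap_iff (algebraMap ℚ K).injective).mp hq
  obtain ⟨n, hn⟩ := IsIntegrallyClosed.isIntegral_iff.mp h
  exact ⟨n, by simpa using hn⟩

lemma sh_fixed_int {K : Type*} [Field K] [NumberField K] [IsGalois ℚ K] (σ : K ≃ₐ[ℚ] K)
    (gen : ∀ τ : K ≃ₐ[ℚ] K, τ ∈ Subgroup.zpowers σ) (x : K) (hx : σ x = x) 
    (hi : IsIntegral ℤ x) : ∃ n : ℤ, (n : K) = x := by
  obtain ⟨q, rfl⟩ := sh_fixed_rat σ gen x hx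
  obtain ⟨n, rfl⟩ := sh_rat_int q hi
  exact ⟨n, by simp⟩

lemma sh_fix2 {K : Type*} [Field K] [NumberField K] [IsGalois ℚ K] (σ : K ≃ₐ[ℚ] K)
    (gen : ∀ τ : K ≃ₐ[ℚ] K, τ ∈ Subgroup.zpowers σ) (β : K) (hβ : β ^ 2 = -1) (hb : σ β = -β)
    (x : K) (hx : σ (σ x) = x) (hi : IsIntegral ℤ x) : ∃ m n : ℤ, x = m + n * β := by
  have hβi : IsIntegral ℤ β := by
    refine ⟨Polynomial.X ^ 2 + 1, by monicity!, ?_⟩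
    simp [hβ]
  have hsi : IsIntegral ℤ (σ x) := map_isIntegral_int σ hi
  obtain ⟨A, hA⟩ := sh_fixed_int σ gen (x + σ x) (by rw [map_add, hx, add_comm]) (hi.add hsi)
  obtain ⟨B, hB⟩ := sh_fixed_int σ gen ((σ x - x) * β) (by rw [map_mul, map_sub, hx, hb]; ring)
    ((hsi.sub hi).mul hβi)
  obtain ⟨C, hC⟩ := sh_fixed_int σ gen (x * σ x) (by rw [map_mul, hx, mul_comm]) (hi.mul hsi)
  have h4 : A ^ 2 + B ^ 2 = 4 * C := by
    have : ((A ^ 2 + B ^ 2 : ℤ) : K) = ((4 * C : ℤ) : K) := by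
      push_cast; rw [hA, hB, hC]; linear_combination (σ x - x) ^ 2 * hβ
    exact_mod_cast this
  have hA2 : A % 2 = 0 ∧ B % 2 = 0 := by
    have h5 : (A ^ 2 + B ^ 2) % 4 = 0 := by omega
    have hA4 : A % 4 = 0 ∨ A % 4 = 1 ∨ A % 4 = 2 ∨ A % 4 = 3 := by omega
    have hB4 : B % 4 = 0 ∨ B % 4 = 1 ∨ B % 4 = 2 ∨ B % 4 = 3 := by omega
    rcases hA4 with h | h | h | h <;> rcases hB4 with h' | h' | h' | h' <;>
      simp [Int.add_emod, pow_two, Int.mul_emod, h, h'] at h5 <;> omega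
  refine ⟨A / 2, B / 2, ?_⟩
  obtain ⟨a, rfl⟩ : (2 : ℤ) ∣ A := by omega
  obtain ⟨c, rfl⟩ : (2 : ℤ) ∣ B := by omega
  rw [Int.mul_ediv_cancel_left _ (by norm_num), Int.mul_ediv_cancel_left _ (by norm_num)]
  push_cast at hA hB
  have : (2 : K) * x = 2 * (a + c * β) := by
    linear_combination -hA - β * hB - (σ x - x) * hβ
  exact mul_left_cancel₀ two_ne_zero this

lemma sh_conj {K : Type*} [Field K] [NumberField K] [IsGalois ℚ K] (σ : K ≃ₐ[ℚ] K)
    (gen : ∀ τ : K ≃ₐ[ℚ] K, τ ∈ Subgroup.zpowers σ) (ho : orderOf σ = 6)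
    (β : K) (hβ : β ^ 2 = -1) (hb : σ β = -β) (φ : K →+* ℂ) (x : K) :
    φ ((σ ^ 3) x) = (starRingEnd ℂ) (φ x) := by
  obtain ⟨τ, hτ⟩ := NumberField.ComplexEmbedding.exists_comp_symm_eq_of_comp_eq (k := ℚ) φ
    ((starRingEnd ℂ).comp φ) (Subsingleton.elim _ _)
  have h1 : ∀ y, φ (τ.symm y) = (starRingEnd ℂ) (φ y) := fun y => RingHom.congr_fun hτ y
  obtain ⟨k, hk⟩ := Subgroup.mem_zpowers_iff.mp (gen τ.symm)
  have h2 : τ.symm * τ.symm = 1 := by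
    ext y
    apply φ.injective
    rw [AlgEquiv.mul_apply, h1, h1]; simp
  have h3 : (6 : ℤ) ∣ 2 * k := by
    rw [← hk, ← zpow_add] at h2
    have := orderOf_dvd_iff_zpow_eq_one.mpr h2
    rw [ho] at this
    push_cast at this
    rwa [two_mul]
  have hβ0 : β ≠ 0 := by rintro rfl; norm_num at hβ
  have h4 : τ.symm β ≠ β := by
    intro h
    have := h1 β
    rw [h] at this
    have h5 : (φ β) ^ 2 = -1 := by rw [← map_pow, hβ]; simp
    obtain ⟨r, hr⟩ := Complex.conj_eq_iff_real.mp this.symm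
    rw [hr] at h5
    have h6 : r ^ 2 = -1 := by exact_mod_cast h5
    nlinarith [sq_nonneg r]
  have h5 : ¬ (6 : ℤ) ∣ k := by
    intro h
    apply h4
    have : σ ^ k = 1 := by rw [← orderOf_dvd_iff_zpow_eq_one, ho]; exact_mod_cast h
    rw [← hk, this]; rfl
  have h6 : σ ^ k = σ ^ 3 := by
    have : σ ^ (k - 3) = 1 := by
      rw [← orderOf_dvd_iff_zpow_eq_one, ho]; push_cast; omega
    rw [zpow_sub, mul_inv_eq_one] at this
    rw [this]; norm_cast
  rw [← h6, hk, h1]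

lemma sh_setup_exists (K : Type*) [Field K] [NumberField K]
    (hdeg : Module.finrank ℚ K = 6) [IsGalois ℚ K] (hcyc : IsCyclic (K ≃ₐ[ℚ] K))
    (α β : K) (hα : α ^ 3 = 93 * α - 124) (hβ : β ^ 2 = (-1 : K)) :
    ∃ (σ : K ≃ₐ[ℚ] K) (b e0 e1 e2 : 𝓞 K),
      ShSetup K σ (galRestrict ℤ ℚ K (𝓞 K) σ) b e0 e1 e2 := by
  obtain ⟨g, hg⟩ := hcyc.exists_generator
  obtain ⟨e0, he0⟩ : ∃ e0, e0 = -(α + 1) / 3 := ⟨_, rfl⟩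
  obtain ⟨e1, he1⟩ : ∃ e1, e1 = (e0 ^ 2 - e0 - 8) / 2 := ⟨_, rfl⟩
  obtain ⟨e2, he2⟩ : ∃ e2, e2 = -1 - e0 - e1 := ⟨_, rfl⟩
  have hc0 : e0 ^ 3 + e0 ^ 2 - 10 * e0 - 8 = 0 := by
    rw [he0]; field_simp; linear_combination (-1) * hα
  have hc1 : e1 ^ 3 + e1 ^ 2 - 10 * e1 - 8 = 0 := by
    rw [he1]; field_simp
    linear_combination (e0 ^ 3 - 4 * e0 ^ 2 - 5 * e0 + 16) * hc0
  have hq0 : e0 ^ 2 = e0 + 2 * e1 + 8 := by rw [he1]; field_simp; ring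
  have h12 : e2 = (e1 ^ 2 - e1 - 8) / 2 := by
    rw [he2, he1]; field_simp; linear_combination (-e0 + 3) * hc0
  have h20 : e0 = (e2 ^ 2 - e2 - 8) / 2 := by
    have : e2 = (6 - e0 - e0 ^ 2) / 2 := by rw [he2, he1]; field_simp; ring
    rw [this]; field_simp; linear_combination (-e0 - 1) * hc0
  have hi0 : IsIntegral ℤ e0 := by
    refine ⟨Polynomial.X ^ 3 + Polynomial.X ^ 2 - 10 * Polynomial.X - 8, by monicity!, ?_⟩
    simpa using hc0
  have hi1 : IsIntegral ℤ e1 := by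
    refine ⟨Polynomial.X ^ 3 + Polynomial.X ^ 2 - 10 * Polynomial.X - 8, by monicity!, ?_⟩
    simpa using hc1
  have hi2 : IsIntegral ℤ e2 := by
    rw [he2]; exact (((isIntegral_one).neg).sub hi0).sub hi1
  have hbi : IsIntegral ℤ β := by
    refine ⟨Polynomial.X ^ 2 + 1, by monicity!, ?_⟩
    simp [hβ]
  have hfac : ∀ y : K, y ^ 3 + y ^ 2 - 10 * y - 8 = (y - e0) * (y - e1) * (y - e2) := by
    intro y
    rw [he2, he1]; field_simp
    linear_combination (y * (e0 - 1) - e0 ^ 2 + e0 + 4) * hc0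
  have hof : ∀ (τ : K ≃ₐ[ℚ] K), τ 10 = 10 ∧ τ 8 = 8 ∧ τ 2 = 2 := fun τ =>
    ⟨map_ofNat τ 10, map_ofNat τ 8, map_ofNat τ 2⟩
  have hpoly : ∀ (τ : K ≃ₐ[ℚ] K) (x y : K), y = (x ^ 2 - x - 8) / 2 →
      τ y = ((τ x) ^ 2 - τ x - 8) / 2 := by
    intro τ x y h
    rw [h, map_div₀, map_sub, map_sub, map_pow, (hof τ).2.1, (hof τ).2.2]
  -- the generator moves e0
  have hg0 : ∀ τ : K ≃ₐ[ℚ] K, (∀ t, t ∈ Subgroup.zpowers τ) → τ e0 ≠ e0 := by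
    intro τ hτ h
    obtain ⟨n, hn⟩ := sh_fixed_int τ hτ e0 h hi0
    rw [← hn] at hc0
    have h1 : n ^ 3 + n ^ 2 - 10 * n - 8 = 0 := by exact_mod_cast hc0
    have h2 := congrArg (Int.cast : ℤ → ZMod 3) h1
    push_cast at h2
    generalize (n : ZMod 3) = m at h2
    revert m; decide
  have key : ∃ σ : K ≃ₐ[ℚ] K, (∀ t, t ∈ Subgroup.zpowers σ) ∧ σ e0 = e1 := by
    have hr : (g e0 - e0) * (g e0 - e1) * (g e0 - e2) = 0 := by
      rw [← hfac]
      have := congrArg g hc0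
      simpa [hof g] using this
    rcases mul_eq_zero.mp hr with hr | hr
    · rcases mul_eq_zero.mp hr with hr | hr
      · exact absurd (sub_eq_zero.mp hr) (hg0 g hg)
      · exact ⟨g, hg, sub_eq_zero.mp hr⟩
    · refine ⟨g⁻¹, by simpa [Subgroup.zpowers_inv] using hg, ?_⟩
      have h1 : g e0 = e2 := sub_eq_zero.mp hr
      have h2 : g e1 = e0 := by
        rw [hpoly g e0 e1 he1, h1, ← h20]
      rw [← h2]; exact g.symm_apply_apply e1
  obtain ⟨σ, hσ, h01⟩ := key
  have hσ1 : σ e1 = e2 := by rw [hpoly σ e0 e1 he1, h01, ← h12]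
  have hσ2 : σ e2 = e0 := by
    rw [he2]; simp only [map_sub, map_neg, map_one, h01, hσ1]; rw [he2]; ring
  have hσb : σ β = -β := by
    have h1 : (σ β - β) * (σ β + β) = 0 := by
      have : σ β ^ 2 = -1 := by rw [← map_pow, hβ]; simp
      linear_combination this - hβ
    rcases mul_eq_zero.mp h1 with h | h
    · obtain ⟨n, hn⟩ := sh_fixed_int σ hσ β (sub_eq_zero.mp h) hbi
      rw [← hn] at hβ
      have : n ^ 2 = -1 := by exact_mod_cast hβ
      nlinarith [sq_nonneg n]
    · exact eq_neg_of_add_eq_zero_left h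
  have ho : orderOf σ = 6 := by
    rw [orderOf_eq_card_of_forall_mem_zpowers hσ, IsGalois.card_aut_eq_finrank, hdeg]
  have hs : ∀ x : 𝓞 K, ((galRestrict ℤ ℚ K (𝓞 K) σ x : 𝓞 K) : K) = σ (x : K) := fun x =>
    algebraMap_galRestrict_apply ℤ σ x
  obtain ⟨b, hb⟩ : ∃ b : 𝓞 K, (b : K) = β := ⟨⟨β, hbi⟩, rfl⟩
  obtain ⟨f0, hf0⟩ : ∃ b : 𝓞 K, (b : K) = e0 := ⟨⟨e0, hi0⟩, rfl⟩
  obtain ⟨f1, hf1⟩ : ∃ b : 𝓞 K, (b : K) = e1 := ⟨⟨e1, hi1⟩, rfl⟩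
  obtain ⟨f2, hf2⟩ : ∃ b : 𝓞 K, (b : K) = e2 := ⟨⟨e2, hi2⟩, rfl⟩
  refine ⟨σ, b, f0, f1, f2, ?_⟩
  have n2 : (algebraMap (𝓞 K) K) 2 = 2 := map_ofNat _ 2
  have n4 : (algebraMap (𝓞 K) K) 4 = 4 := map_ofNat _ 4
  have n6 : (algebraMap (𝓞 K) K) 6 = 6 := map_ofNat _ 6
  have n7 : (algebraMap (𝓞 K) K) 7 = 7 := map_ofNat _ 7
  have n8 : (algebraMap (𝓞 K) K) 8 = 8 := map_ofNat _ 8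
  refine ⟨hdeg, hs, hσ, ho, ?_, ?_, ?_, ?_, ?_, ?_, ?_, ?_, ?_, ?_, ?_, ?_, ?_,
    sh_conj σ hσ ho β hβ hσb, ?_⟩
  · intro x
    apply RingOfIntegers.ext
    simp only [hs]
    have : (σ ^ 6) (x : K) = x := by rw [← ho, pow_orderOf_eq_one]; rfl
    exact this
  · apply RingOfIntegers.ext; simp [← hβ, pow_two, hb]
  · apply RingOfIntegers.ext; rw [hs]; simpa [hb] using hσb
  · apply RingOfIntegers.ext; rw [hs, hf0, hf1, h01]
  · apply RingOfIntegers.ext; rw [hs, hf1, hf2, hσ1]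
  · apply RingOfIntegers.ext; rw [hs, hf2, hf0, hσ2]
  · apply RingOfIntegers.ext; simp [he2, hf0, hf1, hf2]
  · apply RingOfIntegers.ext; simp [n2, n4, n6, n7, n8, hf0, hf1, hf2, he2]; linear_combination hq0
  · apply RingOfIntegers.ext; simp [n2, n4, n6, n7, n8, hf0, hf1, hf2, he2, he1]; field_simp
    linear_combination (e0 - 3) * hc0
  · apply RingOfIntegers.ext; simp [n2, n4, n6, n7, n8, hf0, hf1, hf2, he2, he1]; field_simp
    linear_combination (e0 + 1) * hc0
  · apply RingOfIntegers.ext; simp [n2, n4, n6, n7, n8, hf0, hf1, hf2, he2, he1]; field_simp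
    linear_combination hc0
  · apply RingOfIntegers.ext; simp [n2, n4, n6, n7, n8, hf0, hf1, hf2, he2, he1]; field_simp
    linear_combination (-e0 + 1) * hc0
  · apply RingOfIntegers.ext; simp [n2, n4, n6, n7, n8, hf0, hf1, hf2, he2, he1]; field_simp
    linear_combination (-1) * hc0
  · intro x hx
    obtain ⟨m, n, h⟩ := sh_fix2 σ hσ β hβ hσb (x : K)
      (by rw [← hs, ← hs, hx]) x.isIntegral_coe
    refine ⟨m, n, RingOfIntegers.ext ?_⟩
    simpa [hb] using h


/-- The set of candidates for the value of the character at `I`. -/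
def ShT {K : Type*} [Field K] [NumberField K] (s : 𝓞 K ≃ₐ[ℤ] 𝓞 K) (I : Ideal (𝓞 K))
    (μ : 𝓞 K) : Prop :=
  Ideal.span {μ} = I * Ideal.map (s ^ 4) I * Ideal.map (s ^ 5) I ∧
    μ * (s ^ 3) μ = (Ideal.absNorm I : 𝓞 K)

section
variable {K : Type*} [Field K] [NumberField K] [IsGalois ℚ K] {σ : K ≃ₐ[ℚ] K}
  {s : 𝓞 K ≃ₐ[ℤ] 𝓞 K} {b e0 e1 e2 : 𝓞 K}

lemma sh_pows (H : ShSetup K σ s b e0 e1 e2) (n : ℕ) (x : 𝓞 K) :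
    (((s ^ n) x : 𝓞 K) : K) = (σ ^ n) (x : K) := by
  induction n generalizing x with
  | zero => rfl
  | succ n ih => rw [pow_succ, pow_succ, AlgEquiv.mul_apply, ih, H.hs]; rfl

lemma sh_s6 (H : ShSetup K σ s b e0 e1 e2) : s ^ 6 = 1 := by
  ext x
  exact congrArg _ (H.s6 x)

lemma sh_norm (H : ShSetup K σ s b e0 e1 e2) (x : 𝓞 K) :
    ((Algebra.norm ℤ x : ℤ) : 𝓞 K) = x * s x * (s ^ 2) x * (s ^ 3) x * (s ^ 4) x * (s ^ 5) x := by
  apply RingOfIntegers.ext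
  have h1 : ((Algebra.norm ℤ x : ℤ) : K) = algebraMap ℚ K (Algebra.norm ℚ (x : K)) := by
    rw [← Algebra.coe_norm_int]; simp
  have h2 := Algebra.norm_eq_prod_automorphisms ℚ (x : K)
  classical
  rw [← IsCyclic.image_range_orderOf H.gen, H.ord, Finset.prod_image] at h2
  · simp only [map_mul, sh_pows H, H.hs]
    simp only [map_intCast]
    rw [h1, h2]
    simp [Finset.prod_range_succ]
  · intro i hi j hj hij
    simp only [Finset.coe_range, Set.mem_Iio] at hi hj
    exact pow_injOn_Iio_orderOf (by simpa [H.ord] using hi) (by simpa [H.ord] using hj) hij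

lemma sh_norm_phi (H : ShSetup K σ s b e0 e1 e2) (x : 𝓞 K) :
    ((Algebra.norm ℤ x : ℤ) : 𝓞 K) = (x * (s ^ 4) x * (s ^ 5) x) *
      (s ^ 3) (x * (s ^ 4) x * (s ^ 5) x) := by
  have h6 := sh_s6 H
  have e1 : ∀ y, (s ^ 3) ((s ^ 4) y) = s y := by
    intro y; rw [← AlgEquiv.mul_apply, ← pow_add, show 3 + 4 = 6 + 1 by norm_num, pow_add, h6]; simp
  have e2 : ∀ y, (s ^ 3) ((s ^ 5) y) = (s ^ 2) y := by
    intro y; rw [← AlgEquiv.mul_apply, ← pow_add, show 3 + 5 = 6 + 2 by norm_num, pow_add, h6]; simp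
  rw [map_mul, map_mul, e1, e2, sh_norm H]; ring

lemma sh_pos (H : ShSetup K σ s b e0 e1 e2) (z : 𝓞 K) (n : ℤ) (h : (n : 𝓞 K) = z * (s ^ 3) z) :
    0 ≤ n := by
  obtain ⟨φ⟩ : Nonempty (K →+* ℂ) := inferInstance
  have h1 : ((n : ℤ) : K) = (z : K) * (σ ^ 3) (z : K) := by
    rw [← sh_pows H, ← map_mul, ← h]; simp
  have h2 := congrArg φ h1
  rw [map_mul, H.conj, Complex.mul_conj] at h2
  have h3 : (n : ℝ) = Complex.normSq (φ z) := by
    have : ((n : ℝ) : ℂ) = ((Complex.normSq (φ z) : ℝ) : ℂ) := by rw [← h2]; simp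
    exact_mod_cast this
  have : (0 : ℝ) ≤ n := h3 ▸ Complex.normSq_nonneg _
  exact_mod_cast this

lemma sh_absNorm_span (H : ShSetup K σ s b e0 e1 e2) (x : 𝓞 K) :
    ((Ideal.absNorm (Ideal.span {x}) : ℕ) : 𝓞 K) = (x * (s ^ 4) x * (s ^ 5) x) *
      (s ^ 3) (x * (s ^ 4) x * (s ^ 5) x) := by
  have h := sh_norm_phi H x
  rw [← h, Ideal.absNorm_span_singleton]
  have := sh_pos H _ _ h
  have h2 : (((Algebra.norm ℤ x).natAbs : ℤ) : 𝓞 K) = ((Algebra.norm ℤ x : ℤ) : 𝓞 K) := by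
    rw [Int.natAbs_of_nonneg this]
  rw [← h2]; simp

lemma sh_map_span (t : 𝓞 K ≃ₐ[ℤ] 𝓞 K) (x : 𝓞 K) :
    Ideal.map t (Ideal.span {x}) = Ideal.span {t x} := by
  rw [Ideal.map_span, Set.image_singleton]

lemma sh_T_principal (H : ShSetup K σ s b e0 e1 e2) (x : 𝓞 K) :
    ShT s (Ideal.span {x}) (x * (s ^ 4) x * (s ^ 5) x) := by
  refine ⟨?_, (sh_absNorm_span H x).symm⟩
  rw [sh_map_span, sh_map_span, Ideal.span_singleton_mul_span_singleton,
    Ideal.span_singleton_mul_span_singleton]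

lemma sh_T_mul {I J : Ideal (𝓞 K)} {μ ν : 𝓞 K} (hI : ShT s I μ) (hJ : ShT s J ν) :
    ShT s (I * J) (μ * ν) := by
  obtain ⟨h1, h2⟩ := hI
  obtain ⟨h3, h4⟩ := hJ
  refine ⟨?_, ?_⟩
  · rw [← Ideal.span_singleton_mul_span_singleton, h1, h3, Ideal.map_mul, Ideal.map_mul]; ring
  · rw [map_mul, map_mul]; push_cast; rw [← h2, ← h4]; ring

lemma sh_T_ne {I : Ideal (𝓞 K)} {μ : 𝓞 K} (hI : ShT s I μ) (h : I ≠ ⊥) : μ ≠ 0 := by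
  rintro rfl
  have := hI.2
  simp only [zero_mul] at this
  have h2 : Ideal.absNorm I = 0 := by exact_mod_cast this.symm
  exact h (Ideal.absNorm_eq_zero_iff.mp h2)

lemma sh_T_quot (H : ShSetup K σ s b e0 e1 e2) {I J : Ideal (𝓞 K)} {x ν : 𝓞 K}
    (hx : x ≠ 0) (hIJ : I * J = Ideal.span {x}) (hJ : ShT s J ν) : ∃ μ, ShT s I μ := by
  have hJ0 : J ≠ ⊥ := by
    rintro rfl
    rw [Ideal.mul_bot] at hIJ
    exact hx (Ideal.span_singleton_eq_bot.mp hIJ.symm)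
  have hν := sh_T_ne hJ hJ0
  obtain ⟨h1, h2⟩ := sh_T_principal H x
  obtain ⟨h3, h4⟩ := hJ
  rw [← hIJ, Ideal.map_mul, Ideal.map_mul,
    show I * J * (Ideal.map (s ^ 4) I * Ideal.map (s ^ 4) J) *
      (Ideal.map (s ^ 5) I * Ideal.map (s ^ 5) J) = (I * Ideal.map (s ^ 4) I * Ideal.map (s ^ 5) I)
      * (J * Ideal.map (s ^ 4) J * Ideal.map (s ^ 5) J) by ring, ← h3] at h1
  have hd : ν ∣ x * (s ^ 4) x * (s ^ 5) x := by
    rw [← Ideal.mem_span_singleton]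
    have : x * (s ^ 4) x * (s ^ 5) x ∈ Ideal.span {x * (s ^ 4) x * (s ^ 5) x} :=
      Ideal.mem_span_singleton_self _
    rw [h1] at this
    exact Ideal.mul_le_right this
  obtain ⟨μ, hμ⟩ := hd
  refine ⟨μ, ?_, ?_⟩
  · rw [hμ, ← Ideal.span_singleton_mul_span_singleton, mul_comm] at h1
    have hν' : Ideal.span {ν} ≠ 0 := by
      rw [Ne, Ideal.zero_eq_bot, Ideal.span_singleton_eq_bot]; exact hν
    exact mul_right_cancel₀ hν' h1
  · rw [hμ, ← hIJ, map_mul, map_mul] at h2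
    push_cast at h2
    rw [← h4] at h2
    have : ν * (s ^ 3) ν ≠ 0 := mul_ne_zero hν (by simpa using hν)
    apply mul_right_cancel₀ this
    rw [← h2]; ring

end


/-- The primary condition on Gaussian integers. -/
def ShPr {K : Type*} [Field K] [NumberField K] (b z : 𝓞 K) : Prop :=
  ∃ m n : ℤ, z = m + n * b ∧ n % 2 = 0 ∧ (m + n) % 4 = 1

/-- The relative norm to the Gaussian field. -/
def ShNm {K : Type*} [Field K] [NumberField K] (s : 𝓞 K ≃ₐ[ℤ] 𝓞 K) (z : 𝓞 K) : 𝓞 K :=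
  z * (s ^ 2) z * (s ^ 4) z

lemma sh_totient (N : ℕ) (h0 : 0 < N) (h4 : 4 ∣ N) (h6 : N.totient ∣ 6) : N = 4 := by
  have h8 : ¬ 8 ∣ N := by
    intro h
    have := (Nat.totient_dvd_of_dvd h).trans h6
    rw [show Nat.totient 8 = 4 by decide] at this
    omega
  obtain ⟨m, rfl⟩ := h4
  have hm : Nat.Coprime 2 m := by
    rw [Nat.Prime.coprime_iff_not_dvd Nat.prime_two]; omega
  have hm4 : Nat.Coprime 4 m := by
    rw [show 4 = 2 ^ 2 by norm_num]; exact Nat.Coprime.pow_left 2 hm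
  rw [Nat.totient_mul hm4, show Nat.totient 4 = 2 by decide] at h6
  have h3 : m.totient ∣ 3 := by
    apply Nat.dvd_of_mul_dvd_mul_left (k := 2) (by norm_num)
    simpa using h6
  by_cases h2 : 2 < m
  · have := Nat.totient_even h2
    have h5 := this.two_dvd.trans h3
    omega
  · have : m ≠ 2 := by rintro rfl; norm_num at hm
    omega

section
variable {K : Type*} [Field K] [NumberField K] [IsGalois ℚ K] {σ : K ≃ₐ[ℚ] K}
  {s : 𝓞 K ≃ₐ[ℤ] 𝓞 K} {b e0 e1 e2 : 𝓞 K}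

lemma sh_unit (H : ShSetup K σ s b e0 e1 e2) (u : 𝓞 K) (hu : u * (s ^ 3) u = 1) :
    u = 1 ∨ u = -1 ∨ u = b ∨ u = -b := by
  have hbb : (b : K) * b = -1 := by rw [← map_mul, H.bb]; simp
  have h1 : (u : K) * (σ ^ 3) (u : K) = 1 := by rw [← sh_pows H, ← map_mul, hu]; simp
  obtain ⟨n, hn, hun⟩ := NumberField.Embeddings.pow_eq_one_of_norm_eq_one K ℂ (x := (u : K))
    u.isIntegral_coe (by
      intro φ
      have h2 := congrArg φ h1
      rw [map_mul, H.conj, Complex.mul_conj, map_one] at h2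
      have h3 : Complex.normSq (φ u) = 1 := by exact_mod_cast h2
      rw [Complex.normSq_eq_norm_sq] at h3
      have := norm_nonneg (φ u)
      nlinarith)
  have ho : 0 < orderOf (u : K) := orderOf_pos_iff.mpr (isOfFinOrder_iff_pow_eq_one.mpr ⟨n, hn, hun⟩)
  have hpu : IsPrimitiveRoot (u : K) (orderOf (u : K)) := IsPrimitiveRoot.orderOf _
  have hpb : IsPrimitiveRoot (b : K) 4 := by
    have : orderOf (b : K) = 2 ^ (1 + 1) := by
      apply orderOf_eq_prime_pow
      · simp only [pow_one, pow_two, hbb]; norm_num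
      · rw [show (b : K) ^ 2 ^ (1 + 1) = ((b : K) * b) * (b * b) by ring, hbb]; norm_num
    have h2 := IsPrimitiveRoot.orderOf (b : K)
    rw [this] at h2
    exact h2
  have hl := IsPrimitiveRoot.pow_mul_pow_lcm hpu hpb ho.ne' (by norm_num)
  have hpos : 0 < Nat.lcm (orderOf (u : K)) 4 := Nat.lcm_pos ho (by norm_num)
  have hdeg := minpoly.degree_dvd (K := ℚ) (hl.isIntegral hpos).tower_top
  rw [← Polynomial.cyclotomic_eq_minpoly_rat hl hpos, Polynomial.natDegree_cyclotomic, H.rank] at hdeg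
  have h4 := sh_totient _ hpos (Nat.dvd_lcm_right _ _) hdeg
  have hd : orderOf (u : K) ∣ 4 := by rw [← h4]; exact Nat.dvd_lcm_left _ _
  have hu4 : (u : K) ^ 4 = 1 := orderOf_dvd_iff_pow_eq_one.mp hd
  have hu4' : u ^ 4 = 1 := by
    apply RingOfIntegers.ext; simpa using hu4
  have : (u - 1) * ((u + 1) * ((u - b) * (u + b))) = 0 := by
    linear_combination hu4' + (u ^ 2 - 1) * (-H.bb)
  rcases mul_eq_zero.mp this with h | h
  · exact Or.inl (sub_eq_zero.mp h)
  rcases mul_eq_zero.mp h with h | h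
  · exact Or.inr (Or.inl (eq_neg_of_add_eq_zero_left h))
  rcases mul_eq_zero.mp h with h | h
  · exact Or.inr (Or.inr (Or.inl (sub_eq_zero.mp h)))
  · exact Or.inr (Or.inr (Or.inr (eq_neg_of_add_eq_zero_left h)))

lemma sh_mn (H : ShSetup K σ s b e0 e1 e2) {m n m' n' : ℤ}
    (h : (m : 𝓞 K) + n * b = m' + n' * b) : m = m' ∧ n = n' := by
  have h1 : ((m - m' : ℤ) : 𝓞 K) = ((n' - n : ℤ) : 𝓞 K) * b := by
    push_cast; linear_combination h
  have h2 : (((m - m') ^ 2 + (n' - n) ^ 2 : ℤ) : 𝓞 K) = 0 := by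
    rw [Int.cast_add, Int.cast_pow, Int.cast_pow, h1]; linear_combination ((n' - n : ℤ) : 𝓞 K) ^ 2 * H.bb
  have h3 : (m - m') ^ 2 + (n' - n) ^ 2 = 0 := by exact_mod_cast h2
  constructor <;> nlinarith [sq_nonneg (m - m'), sq_nonneg (n' - n)]

lemma sh_pr_mul (H : ShSetup K σ s b e0 e1 e2) {z w : 𝓞 K} (hz : ShPr b z) (hw : ShPr b w) :
    ShPr b (z * w) := by
  obtain ⟨m, n, rfl, h1, h2⟩ := hz
  obtain ⟨m', n', rfl, h3, h4⟩ := hw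
  refine ⟨m * m' - n * n', m * n' + n * m', ?_, ?_, ?_⟩
  · push_cast; linear_combination (n * n') * H.bb
  · obtain ⟨k, rfl⟩ : (2 : ℤ) ∣ n := by omega
    obtain ⟨l, rfl⟩ : (2 : ℤ) ∣ n' := by omega
    rw [show m * (2 * l) + 2 * k * m' = 2 * (m * l + k * m') by ring]; omega
  · obtain ⟨k, rfl⟩ : (2 : ℤ) ∣ n := by omega
    obtain ⟨l, rfl⟩ : (2 : ℤ) ∣ n' := by omega
    rw [show m * m' - 2 * k * (2 * l) + (m * (2 * l) + 2 * k * m') =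
      (m + 2 * k) * (m' + 2 * l) + 4 * (-2 * k * l) by ring, Int.add_mul_emod_self_left, Int.mul_emod, h2, h4]
    norm_num

lemma sh_pr_s (H : ShSetup K σ s b e0 e1 e2) {z : 𝓞 K} (hz : ShPr b z) : ShPr b (s z) := by
  obtain ⟨m, n, rfl, h1, h2⟩ := hz
  refine ⟨m, -n, ?_, ?_, ?_⟩
  · rw [map_add, map_mul, H.sb, map_intCast, map_intCast]; push_cast; ring
  · omega
  · omega

lemma sh_pr_ex (H : ShSetup K σ s b e0 e1 e2) {m n : ℤ} (h : (m ^ 2 + n ^ 2) % 2 = 1) :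
    ShPr b (m + n * b) ∨ ShPr b (-(m + n * b)) ∨ ShPr b (b * (m + n * b)) ∨
      ShPr b (-(b * (m + n * b))) := by
  have h' : (m % 2 = 0 ∧ n % 2 = 1) ∨ (m % 2 = 1 ∧ n % 2 = 0) := by
    rcases Int.emod_two_eq_zero_or_one m with h1 | h1 <;>
    rcases Int.emod_two_eq_zero_or_one n with h2 | h2 <;>
      simp [pow_two, Int.add_emod, Int.mul_emod, h1, h2] at h ⊢
  rcases h' with ⟨h1, h2⟩ | ⟨h1, h2⟩
  · right; right
    by_cases h3 : (m - n) % 4 = 1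
    · left; exact ⟨-n, m, by push_cast; linear_combination n * H.bb, by omega, by omega⟩
    · right; exact ⟨n, -m, by push_cast; linear_combination -n * H.bb, by omega, by omega⟩
  · by_cases h3 : (m + n) % 4 = 1
    · left; exact ⟨m, n, rfl, by omega, by omega⟩
    · right; left; exact ⟨-m, -n, by push_cast; ring, by omega, by omega⟩

lemma sh_pr_not (H : ShSetup K σ s b e0 e1 e2) {z : 𝓞 K} (hz : ShPr b z) :
    ¬ ShPr b (-z) ∧ ¬ ShPr b (b * z) ∧ ¬ ShPr b (-(b * z)) := by
  obtain ⟨m, n, rfl, h1, h2⟩ := hz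
  refine ⟨?_, ?_, ?_⟩
  · rintro ⟨m', n', h, h3, h4⟩
    obtain ⟨rfl, rfl⟩ := sh_mn H (m := -m) (n := -n) (m' := m') (n' := n')
      (by push_cast; linear_combination h)
    omega
  · rintro ⟨m', n', h, h3, h4⟩
    obtain ⟨rfl, rfl⟩ := sh_mn H (m := -n) (n := m) (m' := m') (n' := n')
      (by push_cast; linear_combination h - n * H.bb)
    omega
  · rintro ⟨m', n', h, h3, h4⟩
    obtain ⟨rfl, rfl⟩ := sh_mn H (m := n) (n := -m) (m' := m') (n' := n')
      (by push_cast; linear_combination h + n * H.bb)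
    omega

lemma sh_nm_mul (z w : 𝓞 K) : ShNm s (z * w) = ShNm s z * ShNm s w := by
  simp only [ShNm, map_mul]; ring

lemma sh_nm_b (H : ShSetup K σ s b e0 e1 e2) : ShNm s b = -b := by
  have h2 : (s ^ 2) b = b := by
    rw [pow_two, AlgEquiv.mul_apply, H.sb, map_neg, H.sb, neg_neg]
  have h4 : (s ^ 4) b = b := by
    rw [show 4 = 2 + 2 by norm_num, pow_add, AlgEquiv.mul_apply, h2, h2]
  rw [ShNm, h2, h4, H.bb]; ring

lemma sh_nm_neg (z : 𝓞 K) : ShNm s (-z) = -ShNm s z := by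
  simp only [ShNm, map_neg]; ring

lemma sh_s3b (H : ShSetup K σ s b e0 e1 e2) : (s ^ 3) b = -b := by
  change s (s (s b)) = -b
  rw [H.sb, map_neg, H.sb, neg_neg, H.sb]

lemma sh_T_unique (H : ShSetup K σ s b e0 e1 e2) {I : Ideal (𝓞 K)} (hI : I ≠ ⊥) {μ ν : 𝓞 K}
    (h1 : ShT s I μ) (h2 : ShT s I ν) (p1 : ShPr b (ShNm s μ)) (p2 : ShPr b (ShNm s ν)) :
    μ = ν := by
  have hμ := sh_T_ne h1 hI
  obtain ⟨u, hu⟩ := Ideal.span_singleton_eq_span_singleton.mp (h1.1.trans h2.1.symm)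
  have h3 := h2.2
  rw [← hu, ← h1.2, map_mul] at h3
  have h4 : (u : 𝓞 K) * (s ^ 3) (u : 𝓞 K) = 1 := by
    have : μ * (s ^ 3) μ ≠ 0 := mul_ne_zero hμ (by simpa using hμ)
    apply mul_left_cancel₀ this
    linear_combination h3
  rw [← hu, sh_nm_mul] at p2
  obtain ⟨n1, n2, n3⟩ := sh_pr_not H p1
  have e1 : ShNm s (1 : 𝓞 K) = 1 := by simp [ShNm]
  rcases sh_unit H _ h4 with h | h | h | h
  · rw [← hu, h, mul_one]
  · rw [h, sh_nm_neg, e1, mul_neg_one] at p2; exact absurd p2 n1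
  · rw [h, sh_nm_b H, mul_neg, mul_comm] at p2; exact absurd p2 n3
  · rw [h, sh_nm_neg, sh_nm_b H, neg_neg, mul_comm] at p2; exact absurd p2 n2

lemma sh_T_unit {I : Ideal (𝓞 K)} {μ u : 𝓞 K}
    (h1 : ShT s I μ) (hu : u * (s ^ 3) u = 1) : ShT s I (u * μ) := by
  refine ⟨?_, ?_⟩
  · rw [← h1.1]
    apply Ideal.span_singleton_eq_span_singleton.mpr
    exact associated_unit_mul_left _ _ (IsUnit.of_mul_eq_one _ hu)
  · rw [map_mul, ← h1.2]; linear_combination (μ * (s ^ 3) μ) * hu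

lemma sh_nm_fix (H : ShSetup K σ s b e0 e1 e2) (z : 𝓞 K) : ∃ m n : ℤ, ShNm s z = m + n * b ∧
    ((m ^ 2 + n ^ 2 : ℤ) : 𝓞 K) = ShNm s (z * (s ^ 3) z) := by
  obtain ⟨m, n, h⟩ := H.fix2 (ShNm s z) (by
    change s (s (z * s (s z) * s (s (s (s z))))) = z * s (s z) * s (s (s (s z)))
    simp only [map_mul, H.s6]; ring)
  refine ⟨m, n, h, ?_⟩
  have h2 : ShNm s ((s ^ 3) z) = (s ^ 3) (ShNm s z) := by
    simp only [ShNm, map_mul, ← AlgEquiv.mul_apply, ← pow_add]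
  rw [sh_nm_mul, h2, h, map_add, map_mul, sh_s3b H, map_intCast, map_intCast]
  push_cast; linear_combination n ^ 2 * H.bb

lemma sh_T_primary (H : ShSetup K σ s b e0 e1 e2) {I : Ideal (𝓞 K)} 
    (hodd : Ideal.absNorm I % 2 = 1) {μ : 𝓞 K} (h1 : ShT s I μ) :
    ∃ ν, ShT s I ν ∧ ShPr b (ShNm s ν) := by
  obtain ⟨m, n, h, h2⟩ := sh_nm_fix H μ
  rw [h1.2] at h2
  have h3 : m ^ 2 + n ^ 2 = (Ideal.absNorm I : ℤ) ^ 3 := by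
    have : ((m ^ 2 + n ^ 2 : ℤ) : 𝓞 K) = (((Ideal.absNorm I : ℤ) ^ 3 : ℤ) : 𝓞 K) := by
      rw [h2]; simp [ShNm]; ring
    exact_mod_cast this
  have h4 : (m ^ 2 + n ^ 2) % 2 = 1 := by
    rw [h3]
    have : (Ideal.absNorm I : ℤ) % 2 = 1 := by omega
    simp [pow_succ, Int.mul_emod, this]
  have hb : b * (s ^ 3) b = 1 := by rw [sh_s3b H, mul_neg, H.bb, neg_neg]
  have hm1 : (-1 : 𝓞 K) * (s ^ 3) (-1) = 1 := by simp
  rcases sh_pr_ex H h4 with h5 | h5 | h5 | h5 <;> rw [← h] at h5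
  · exact ⟨μ, h1, h5⟩
  · refine ⟨-μ, by simpa using sh_T_unit h1 hm1, by rwa [sh_nm_neg]⟩
  · refine ⟨-(b * μ), by simpa using sh_T_unit (sh_T_unit h1 hb) hm1, ?_⟩
    rwa [sh_nm_neg, sh_nm_mul, sh_nm_b H, neg_mul, neg_neg]
  · refine ⟨b * μ, sh_T_unit h1 hb, ?_⟩
    rwa [sh_nm_mul, sh_nm_b H, neg_mul]

end


section
variable {K : Type*} [Field K] [NumberField K] [IsGalois ℚ K] {σ : K ≃ₐ[ℚ] K}
  {s : 𝓞 K ≃ₐ[ℤ] 𝓞 K} {b e0 e1 e2 : 𝓞 K}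

lemma sh_trace (H : ShSetup K σ s b e0 e1 e2) (x : 𝓞 K) (t : ℤ)
    (h : x + s x + s (s x) + s (s (s x)) + s (s (s (s x))) + s (s (s (s (s x)))) = t) :
    Algebra.trace ℤ (𝓞 K) x = t := by
  have h0 : (t : K) = ∑ τ : K ≃ₐ[ℚ] K, τ (x : K) := by
    classical
    rw [← IsCyclic.image_range_orderOf H.gen, H.ord, Finset.sum_image]
    · have := congrArg (algebraMap (𝓞 K) K) h
      simp only [map_add, H.hs, map_intCast] at this
      rw [← this]
      simp [Finset.sum_range_succ, pow_succ]
    · intro i hi j hj hij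
      simp only [Finset.coe_range, Set.mem_Iio] at hi hj
      exact pow_injOn_Iio_orderOf (by simpa [H.ord] using hi) (by simpa [H.ord] using hj) hij
  rw [← trace_eq_sum_automorphisms, ← Algebra.coe_trace_int] at h0
  have : ((t : ℚ) : K) = ((Algebra.trace ℤ (𝓞 K) x : ℚ) : K) := by simpa using h0
  have h2 := (Rat.cast_injective this)
  exact_mod_cast h2.symm

lemma sh_discr (H : ShSetup K σ s b e0 e1 e2) : |discr K| ≤ 64 * 31 ^ 4 := by
  classical
  have hr : Module.finrank ℤ (𝓞 K) = Fintype.card (Fin 3 ⊕ Fin 3) := by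
    rw [RingOfIntegers.rank, H.rank]; simp
  let B : Module.Basis (Fin 3 ⊕ Fin 3) ℤ (𝓞 K) :=
    (Module.finBasis ℤ (𝓞 K)).reindex ((finCongr hr).trans (Fintype.equivFin _).symm)
  let v : Fin 3 ⊕ Fin 3 → 𝓞 K := Sum.elim ![e0, e1, e2] ![b * e0, b * e1, b * e2]
  have h1 : Algebra.discr ℤ v = (B.toMatrix v).det ^ 2 * discr K := by
    rw [← NumberField.discr_eq_discr K B, ← Algebra.discr_of_matrix_vecMul]
    congr 1
    funext j
    rw [← B.sum_toMatrix_smul_self v j]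
    simp [Matrix.vecMul, dotProduct, mul_comm, Algebra.smul_def]
  let A : Matrix (Fin 3) (Fin 3) ℤ := !![42, -20, -20; -20, 42, -20; -20, -20, 42]
  have h2 : Algebra.discr ℤ v = -(64 * 31 ^ 4) := by
    rw [Algebra.discr_def]
    have : Algebra.traceMatrix ℤ v = Matrix.fromBlocks A 0 0 (-A) := by
      have t00 : ∀ x y : 𝓞 K, Algebra.traceForm ℤ (𝓞 K) x y = Algebra.trace ℤ (𝓞 K) (x * y) :=
        fun x y => rfl
      have hbb := H.bb
      have hsum := H.sum
      have m00 := H.m00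
      have m01 := H.m01
      have m02 := H.m02
      have m11 := H.m11
      have m12 := H.m12
      have m22 := H.m22
      clear h1
      ext i j
      rw [Algebra.traceMatrix_apply, t00]
      apply sh_trace H
      rcases i with i | i <;> rcases j with j | j <;> fin_cases i <;> fin_cases j <;>
        simp [v, A, H.s0, H.s1, H.s2, H.sb] 
      all_goals grind
    rw [this, Matrix.det_fromBlocks_zero₂₁, Matrix.det_neg, Matrix.det_fin_three]
    simp [A]
  have h3 : (B.toMatrix v).det ≠ 0 := by
    intro h; rw [h] at h1; rw [h1] at h2; norm_num at h2
  have h4 : 1 ≤ (B.toMatrix v).det ^ 2 := by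
    have : 0 < (B.toMatrix v).det ^ 2 := by positivity
    omega
  have h5 : (B.toMatrix v).det ^ 2 * |discr K| = 64 * 31 ^ 4 := by
    rw [← abs_of_nonneg (by positivity : 0 ≤ (B.toMatrix v).det ^ 2), ← abs_mul, ← h1, h2]; norm_num
  nlinarith [abs_nonneg (discr K)]

end


section
variable {K : Type*} [Field K] [NumberField K] [IsGalois ℚ K] {σ : K ≃ₐ[ℚ] K}
  {s : 𝓞 K ≃ₐ[ℤ] 𝓞 K} {b e0 e1 e2 : 𝓞 K}

lemma sh_minkowski (H : ShSetup K σ s b e0 e1 e2) (C : ClassGroup (𝓞 K)) :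
    ∃ I : nonZeroDivisors (Ideal (𝓞 K)), ClassGroup.mk0 I = C ∧
      Ideal.absNorm (I : Ideal (𝓞 K)) ≤ 250 := by
  obtain ⟨I, hI, h⟩ := NumberField.exists_ideal_in_class_of_norm_le C
  refine ⟨I, hI, ?_⟩
  rw [H.rank] at h
  have hr : InfinitePlace.nrComplexPlaces K ≤ 3 := by
    have := InfinitePlace.card_add_two_mul_card_eq_rank K
    rw [H.rank] at this; omega
  have hd : √|(discr K : ℝ)| ≤ 7688 := by
    rw [Real.sqrt_le_left (by norm_num)]
    have := sh_discr H
    have h2 : ((|discr K| : ℤ) : ℝ) ≤ ((64 * 31 ^ 4 : ℤ) : ℝ) := by exact_mod_cast this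
    rw [Int.cast_abs] at h2
    refine h2.trans (by norm_num)
  have hpi : 4 / Real.pi ≤ 4 / 3.14 := by
    have := Real.pi_gt_d2
    gcongr
  have hpi1 : 1 ≤ 4 / Real.pi := by
    rw [one_le_div Real.pi_pos]; exact Real.pi_le_four
  have h3 : (4 / Real.pi) ^ InfinitePlace.nrComplexPlaces K ≤ (4 / 3.14) ^ 3 :=
    (pow_le_pow_right₀ hpi1 hr).trans (pow_le_pow_left₀ (by positivity) hpi 3)
  have h4 : ((Ideal.absNorm (I : Ideal (𝓞 K)) : ℕ) : ℝ) < 251 := by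
    refine h.trans_lt ?_
    calc _ ≤ ((4 / 3.14 : ℝ)) ^ 3 * ((Nat.factorial 6 : ℝ) / 6 ^ 6 * 7688) := by
          refine mul_le_mul h3 ?_ (by positivity) (by positivity)
          refine mul_le_mul ?_ hd (by positivity) (by positivity)
          norm_num
      _ < 251 := by norm_num [Nat.factorial]
  have : Ideal.absNorm (I : Ideal (𝓞 K)) < 251 := by exact_mod_cast h4
  omega

lemma sh_reduce (H : ShSetup K σ s b e0 e1 e2)
    (hP : ∀ P : Ideal (𝓞 K), P.IsPrime → P ≠ ⊥ → Ideal.absNorm P ≤ 250 → ∃ μ, ShT s P μ)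
    (I : Ideal (𝓞 K)) (hI : I ≠ ⊥) : ∃ μ, ShT s I μ := by
  obtain ⟨⟨J, hJ0⟩, hJ, hJn⟩ := sh_minkowski H
    (ClassGroup.mk0 ⟨I, mem_nonZeroDivisors_iff_ne_zero.mpr hI⟩)⁻¹
  have hJ1 : J ≠ ⊥ := nonZeroDivisors.ne_zero hJ0
  simp only at hJn
  -- product of primes
  have key : ∀ J : Ideal (𝓞 K), J ≠ ⊥ → Ideal.absNorm J ≤ 250 → ∃ μ, ShT s J μ := by
    intro J
    induction J using UniqueFactorizationMonoid.induction_on_prime with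
    | h₁ => intro h; exact absurd rfl h
    | h₂ J hu =>
      intro _ _
      rw [Ideal.isUnit_iff] at hu
      rw [hu, ← Ideal.span_singleton_one]
      exact ⟨_, sh_T_principal H 1⟩
    | h₃ J P hJ hP' ih =>
      intro _ hn
      have hPp := Ideal.isPrime_of_prime hP'
      rw [map_mul] at hn
      have h1 : 0 < Ideal.absNorm J := Nat.pos_of_ne_zero (by
        rw [Ne, Ideal.absNorm_eq_zero_iff]; exact hJ)
      have h2 : 0 < Ideal.absNorm P := Nat.pos_of_ne_zero (by
        rw [Ne, Ideal.absNorm_eq_zero_iff]; exact hP'.ne_zero)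
      obtain ⟨μ, hμ⟩ := ih hJ (by nlinarith)
      obtain ⟨ν, hν⟩ := hP P hPp hP'.ne_zero (by nlinarith)
      exact ⟨_, sh_T_mul hν hμ⟩
  obtain ⟨ν, hν⟩ := key J hJ1 hJn
  have h1 : ClassGroup.mk0 (⟨I, mem_nonZeroDivisors_iff_ne_zero.mpr hI⟩ * ⟨J, hJ0⟩) = 1 := by
    rw [map_mul, hJ, mul_inv_cancel]
  have h2 : (I * J).IsPrincipal := (ClassGroup.mk0_eq_one_iff
    (mul_mem (mem_nonZeroDivisors_iff_ne_zero.mpr hI) hJ0)).mp h1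
  obtain ⟨x, hx⟩ := h2
  have hx' : I * J = Ideal.span {x} := hx
  refine sh_T_quot H (x := x) ?_ hx' hν
  rintro rfl
  rw [Ideal.span_singleton_eq_bot.mpr rfl] at hx'
  rcases Ideal.mul_eq_bot.mp hx' with h | h
  · exact hI h
  · exact hJ1 h

end


section
variable {K : Type*} [Field K] [NumberField K] [IsGalois ℚ K] {σ : K ≃ₐ[ℚ] K}
  {s : 𝓞 K ≃ₐ[ℤ] 𝓞 K} {b e0 e1 e2 : 𝓞 K}

lemma sh_absNorm_map (t : 𝓞 K ≃ₐ[ℤ] 𝓞 K) (I : Ideal (𝓞 K)) :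
    Ideal.absNorm (Ideal.map t I) = Ideal.absNorm I := by
  rw [Ideal.absNorm_apply, Ideal.absNorm_apply, Submodule.cardQuot_apply, Submodule.cardQuot_apply]
  exact Nat.card_congr (Ideal.quotientEquiv I (Ideal.map t I) t.toRingEquiv rfl).symm.toEquiv

lemma sh_mem_map (H : ShSetup K σ s b e0 e1 e2) (i j : ℕ) (hij : i + j = 6) (I : Ideal (𝓞 K))
    (x : 𝓞 K) : x ∈ Ideal.map (s ^ i) I ↔ (s ^ j) x ∈ I := by
  rw [Ideal.mem_map_of_equiv]
  have h1 : ∀ y, (s ^ j) ((s ^ i) y) = y := by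
    intro y; rw [← AlgEquiv.mul_apply, ← pow_add, add_comm, hij, sh_s6 H]; rfl
  have h2 : ∀ y, (s ^ i) ((s ^ j) y) = y := by
    intro y; rw [← AlgEquiv.mul_apply, ← pow_add, hij, sh_s6 H]; rfl
  constructor
  · rintro ⟨y, hy, rfl⟩; rwa [h1]
  · intro h; exact ⟨_, h, h2 x⟩

lemma sh_absNorm_cube (H : ShSetup K σ s b e0 e1 e2) {μ : 𝓞 K} {p : ℕ}
    (h : μ * (s ^ 3) μ = p) : Ideal.absNorm (Ideal.span {μ}) = p ^ 3 := by
  have h1 := sh_absNorm_span H μ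
  have h2 : ((Ideal.absNorm (Ideal.span {μ}) : ℕ) : 𝓞 K) = ((p ^ 3 : ℕ) : 𝓞 K) := by
    rw [h1, show μ * (s ^ 4) μ * (s ^ 5) μ * (s ^ 3) (μ * (s ^ 4) μ * (s ^ 5) μ) =
      (μ * (s ^ 3) μ) * (s ^ 4) (μ * (s ^ 3) μ) * (s ^ 5) (μ * (s ^ 3) μ) by
        simp only [map_mul, ← AlgEquiv.mul_apply, ← pow_add]; ring, h]
    simp only [map_natCast]
    push_cast; ring
  exact_mod_cast h2

lemma sh_D1 (H : ShSetup K σ s b e0 e1 e2) {P : Ideal (𝓞 K)} (hP : P.IsPrime) (hP0 : P ≠ ⊥)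
    {μ : 𝓞 K} {p : ℕ} (hp : p.Prime) (h : μ * (s ^ 3) μ = p) (h0 : μ ∈ P) (h1 : s μ ∈ P)
    (h2 : (s ^ 2) μ ∈ P) (hd1 : ¬ ∀ x ∈ P, s x ∈ P) (hd2 : ¬ ∀ x ∈ P, (s ^ 2) x ∈ P) :
    ShT s P μ := by
  have hN := sh_absNorm_cube H h
  have m4 : P ≠ Ideal.map (s ^ 4) P := by
    intro he
    apply hd2
    intro x hx
    rw [he, sh_mem_map H 4 2 rfl] at hx
    exact hx
  have m5 : P ≠ Ideal.map (s ^ 5) P := by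
    intro he
    apply hd1
    intro x hx
    rw [he, sh_mem_map H 5 1 rfl] at hx
    simpa using hx
  have m45 : Ideal.map (s ^ 4) P ≠ Ideal.map (s ^ 5) P := by
    intro he
    apply hd1
    intro x hx
    have h3 : (s ^ 5) x ∈ Ideal.map (s ^ 5) P := Ideal.mem_map_of_mem _ hx
    rw [← he, sh_mem_map H 4 2 rfl, ← AlgEquiv.mul_apply, ← pow_add,
      show 2 + 5 = 6 + 1 by norm_num, pow_add, sh_s6 H] at h3
    simpa using h3
  have hM : P.IsMaximal := hP.isMaximal hP0
  have hM4 : (Ideal.map (s ^ 4) P).IsMaximal := Ideal.map_isMaximal_of_equiv (s ^ 4)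
  have hM5 : (Ideal.map (s ^ 5) P).IsMaximal := Ideal.map_isMaximal_of_equiv (s ^ 5)
  have c4 : IsCoprime P (Ideal.map (s ^ 4) P) := Ideal.isCoprime_of_isMaximal m4
  have c5 : IsCoprime P (Ideal.map (s ^ 5) P) := Ideal.isCoprime_of_isMaximal m5
  have c45 : IsCoprime (Ideal.map (s ^ 4) P) (Ideal.map (s ^ 5) P) :=
    Ideal.isCoprime_of_isMaximal m45
  have hdvd : P * Ideal.map (s ^ 4) P * Ideal.map (s ^ 5) P ∣ Ideal.span {μ} := by
    refine IsCoprime.mul_dvd (IsCoprime.mul_left c5 c45) (IsCoprime.mul_dvd c4 ?_ ?_) ?_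
    · rw [Ideal.dvd_span_singleton]; exact h0
    · rw [Ideal.dvd_span_singleton, sh_mem_map H 4 2 rfl]; exact h2
    · rw [Ideal.dvd_span_singleton, sh_mem_map H 5 1 rfl]; simpa using h1
  obtain ⟨Z, hZ⟩ := hdvd
  have hZN := congrArg Ideal.absNorm hZ
  rw [hN, map_mul, map_mul, map_mul, sh_absNorm_map, sh_absNorm_map] at hZN
  have hPd : Ideal.absNorm P ∣ p ^ 3 := ⟨Ideal.absNorm P * Ideal.absNorm P * Ideal.absNorm Z, by
    rw [hZN]; ring⟩
  obtain ⟨k, hk, hPk⟩ := (Nat.dvd_prime_pow hp).mp hPd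
  have hk0 : k ≠ 0 := by
    rintro rfl
    rw [pow_zero, Ideal.absNorm_eq_one_iff] at hPk
    exact hP.ne_top hPk
  have hp1 := hp.one_lt
  have hple : p ≤ Ideal.absNorm P := by
    rw [hPk]; exact Nat.le_self_pow hk0 p
  have hZ0 : Ideal.absNorm Z ≠ 0 := by
    intro h0; rw [h0, mul_zero] at hZN
    exact absurd hZN (by positivity)
  have h3 : p ^ 3 ≤ Ideal.absNorm P * Ideal.absNorm P * Ideal.absNorm P := by
    calc p ^ 3 = p * p * p := by ring
      _ ≤ _ := by gcongr
  have hZ1 : Ideal.absNorm Z = 1 := by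
    by_contra hne
    have h2 : 2 ≤ Ideal.absNorm Z := by omega
    have : 0 < p ^ 3 := by positivity
    nlinarith
  have hPp : Ideal.absNorm P = p := by
    rw [hZ1, mul_one] at hZN
    by_contra hne
    have hlt : p < Ideal.absNorm P := by omega
    have : p ^ 3 < Ideal.absNorm P ^ 3 := Nat.pow_lt_pow_left hlt (by norm_num)
    nlinarith
  rw [Ideal.absNorm_eq_one_iff] at hZ1
  refine ⟨?_, ?_⟩
  · rw [hZ, hZ1, Ideal.mul_top]
  · rw [h, hPp]

lemma sh_inv31 (H : ShSetup K σ s b e0 e1 e2) {P : Ideal (𝓞 K)} (c0 c1 c2 : 𝓞 K)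
    (h0 : c0 * e0 + c1 * e1 + c2 * e2 ∈ P) (h2 : c0 * e2 + c1 * e0 + c2 * e1 ∈ P)
    (h4 : c0 * e1 + c1 * e2 + c2 * e0 ∈ P) : 31 * c0 ∈ P ∧ 31 * c1 ∈ P := by
  have hsum := H.sum
  have m00 := H.m00
  have m01 := H.m01
  have m02 := H.m02
  have m11 := H.m11
  have m12 := H.m12
  have m22 := H.m22
  constructor
  · have : 31 * c0 = (e0 - 10) * (c0 * e0 + c1 * e1 + c2 * e2) +
      (e2 - 10) * (c0 * e2 + c1 * e0 + c2 * e1) + (e1 - 10) * (c0 * e1 + c1 * e2 + c2 * e0) := by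
      grind
    rw [this]
    exact P.add_mem (P.add_mem (P.mul_mem_left _ h0) (P.mul_mem_left _ h2)) (P.mul_mem_left _ h4)
  · have : 31 * c1 = (e1 - 10) * (c0 * e0 + c1 * e1 + c2 * e2) +
      (e0 - 10) * (c0 * e2 + c1 * e0 + c2 * e1) + (e2 - 10) * (c0 * e1 + c1 * e2 + c2 * e0) := by
      grind
    rw [this]
    exact P.add_mem (P.add_mem (P.mul_mem_left _ h0) (P.mul_mem_left _ h2)) (P.mul_mem_left _ h4)

lemma sh_D2 (H : ShSetup K σ s b e0 e1 e2) {P : Ideal (𝓞 K)} (hP : P.IsPrime) (hP0 : P ≠ ⊥)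
    {p : ℕ} (hp : p.Prime) (hpP : (p : 𝓞 K) ∈ P) (x0 x1 x2 y0 y1 y2 : ℤ)
    (hxy : (x0 * e0 + x1 * e1 + x2 * e2) ^ 2 + (y0 * e0 + y1 * e1 + y2 * e2) ^ 2 = (p : 𝓞 K))
    (hcop : IsCoprime (31 * (x0 * y1 - x1 * y0)) (p : ℤ)) : ∃ μ, ShT s P μ := by
  obtain ⟨μ, hμ⟩ : ∃ μ, μ = (x0 + b * y0) * e0 + (x1 + b * y1) * e1 + (x2 + b * y2) * e2 := ⟨_, rfl⟩
  have f1 : s μ = (x0 - b * y0) * e1 + (x1 - b * y1) * e2 + (x2 - b * y2) * e0 := by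
    rw [hμ]; simp only [map_add, map_mul, H.s0, H.s1, H.s2, H.sb, map_intCast]; ring
  have f2 : s (s μ) = (x0 + b * y0) * e2 + (x1 + b * y1) * e0 + (x2 + b * y2) * e1 := by
    rw [f1]; simp only [map_add, map_sub, map_mul, H.s0, H.s1, H.s2, H.sb, map_intCast]; ring
  have f3 : s (s (s μ)) = (x0 - b * y0) * e0 + (x1 - b * y1) * e1 + (x2 - b * y2) * e2 := by
    rw [f2]; simp only [map_add, map_sub, map_mul, H.s0, H.s1, H.s2, H.sb, map_intCast]; ring
  have f4 : s (s (s (s μ))) = (x0 + b * y0) * e1 + (x1 + b * y1) * e2 + (x2 + b * y2) * e0 := by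
    rw [f3]; simp only [map_add, map_sub, map_mul, H.s0, H.s1, H.s2, H.sb, map_intCast]; ring
  have f5 : s (s (s (s (s μ)))) = (x0 - b * y0) * e2 + (x1 - b * y1) * e0 + (x2 - b * y2) * e1 := by
    rw [f4]; simp only [map_add, map_sub, map_mul, H.s0, H.s1, H.s2, H.sb, map_intCast]; ring
  have hprod : μ * s (s (s μ)) = p := by
    rw [f3, hμ, ← hxy]; linear_combination -(y0 * e0 + y1 * e1 + y2 * e2) ^ 2 * H.bb
  have hpr : ∀ z : 𝓞 K, z * s (s (s z)) = p → s z * s (s (s (s z))) = p := by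
    intro z hz
    have := congrArg s hz
    simpa using this
  have g1 := hpr _ hprod
  have g2 := hpr _ g1
  have g3 := hpr _ g2
  have g4 := hpr _ g3
  have g5 := hpr _ g4
  rw [H.s6] at g3 g4 g5
  have hor : ∀ z w : 𝓞 K, z * w = p → z ∈ P ∨ w ∈ P := by
    intro z w h
    exact hP.mem_or_mem (h ▸ hpP)
  have o0 := hor _ _ hprod
  have o1 := hor _ _ g1
  have o2 := hor _ _ g2
  have hcontra : ∀ β : 𝓞 K, 31 * ((x0 : 𝓞 K) + β * y0) ∈ P → 31 * ((x1 : 𝓞 K) + β * y1) ∈ P →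
      False := by
    intro β h0 h1
    obtain ⟨u, v, huv⟩ := hcop
    have h3 : ((31 * (x0 * y1 - x1 * y0) : ℤ) : 𝓞 K) ∈ P := by
      have : ((31 * (x0 * y1 - x1 * y0) : ℤ) : 𝓞 K) =
        y1 * (31 * ((x0 : 𝓞 K) + β * y0)) - y0 * (31 * ((x1 : 𝓞 K) + β * y1)) := by
        push_cast; ring
      rw [this]
      exact P.sub_mem (P.mul_mem_left _ h0) (P.mul_mem_left _ h1)
    apply hP.ne_top
    rw [Ideal.eq_top_iff_one]
    have h4 : (1 : 𝓞 K) = (u : 𝓞 K) * ((31 * (x0 * y1 - x1 * y0) : ℤ) : 𝓞 K) + v * (p : 𝓞 K) := by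
      have := congrArg (Int.cast : ℤ → 𝓞 K) huv
      push_cast at this ⊢
      exact this.symm
    rw [h4]
    exact P.add_mem (P.mul_mem_left _ h3) (P.mul_mem_left _ hpP)
  have hev : ¬ (μ ∈ P ∧ s (s μ) ∈ P ∧ s (s (s (s μ))) ∈ P) := by
    rintro ⟨h0, h2, h4⟩
    rw [hμ] at h0
    rw [f2] at h2
    rw [f4] at h4
    obtain ⟨k0, k1⟩ := sh_inv31 H _ _ _ h0 h2 h4
    exact hcontra b k0 k1
  have hodd : ¬ (s μ ∈ P ∧ s (s (s μ)) ∈ P ∧ s (s (s (s (s μ)))) ∈ P) := by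
    rintro ⟨h0, h2, h4⟩
    rw [f3] at h2
    rw [f5] at h4
    rw [f1] at h0
    obtain ⟨k0, k1⟩ := sh_inv31 H _ _ _ h2 h4 h0
    exact hcontra (-b) (by rw [neg_mul, ← sub_eq_add_neg]; exact k0)
      (by rw [neg_mul, ← sub_eq_add_neg]; exact k1)
  have hd1 : ¬ ∀ x ∈ P, s x ∈ P := by
    intro hx
    rcases o0 with h | h
    · exact hev ⟨h, hx _ (hx _ h), hx _ (hx _ (hx _ (hx _ h)))⟩
    · have h0 : μ ∈ P := by
        have := hx _ (hx _ (hx _ h)); rwa [H.s6] at this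
      exact hev ⟨h0, hx _ (hx _ h0), hx _ (hx _ (hx _ (hx _ h0)))⟩
  have hd2 : ¬ ∀ x ∈ P, (s ^ 2) x ∈ P := by
    intro hx
    have hx' : ∀ x ∈ P, s (s x) ∈ P := hx
    rcases o0 with h | h
    · exact hev ⟨h, hx' _ h, hx' _ (hx' _ h)⟩
    · have h5 := hx' _ h
      have h1 : s μ ∈ P := by
        have := hx' _ h5; rwa [H.s6] at this
      exact hodd ⟨h1, h, h5⟩
  have fin : ∀ z : 𝓞 K, z * s (s (s z)) = p → z ∈ P → s z ∈ P → s (s z) ∈ P → ∃ μ, ShT s P μ :=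
    fun z hz h0 h1 h2 => ⟨z, sh_D1 H hP hP0 hp hz h0 h1 h2 hd1 hd2⟩
  have F0 := fin _ hprod
  have F1 := fin _ g1
  have F2 := fin _ g2
  have F3 := fin (s (s (s μ))) (by rw [H.s6]; exact g3)
  have F4 := fin (s (s (s (s μ)))) (by rw [H.s6]; exact g4)
  have F5 := fin (s (s (s (s (s μ))))) (by rw [H.s6]; exact g5)
  rw [H.s6] at F4 F5
  rcases o0 with q0 | q0 <;> rcases o1 with q1 | q1 <;> rcases o2 with q2 | q2
  · exact F0 q0 q1 q2
  · exact F5 q2 q0 q1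
  · exact absurd ⟨q0, q2, q1⟩ hev
  · exact F4 q1 q2 q0
  · exact F1 q1 q2 q0
  · exact absurd ⟨q1, q0, q2⟩ hodd
  · exact F2 q2 q0 q1
  · exact F3 q0 q1 q2

lemma sh_D_two (H : ShSetup K σ s b e0 e1 e2) {P : Ideal (𝓞 K)} (hP : P.IsPrime) (hP0 : P ≠ ⊥)
    (h2P : ((2 : ℕ) : 𝓞 K) ∈ P) : ∃ μ, ShT s P μ := by
  have h2 : (2 : 𝓞 K) ∈ P := by simpa using h2P
  have s1b : s (1 + b) = 1 - b := by rw [map_add, map_one, H.sb]; ring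
  have s2b : s (1 - b) = 1 + b := by rw [map_sub, map_one, H.sb]; ring
  have hmul : (1 + b) * (1 - b) = 2 := by linear_combination -H.bb
  have hb : 1 + b ∈ P := by
    rcases hP.mem_or_mem (hmul ▸ h2 : (1 + b) * (1 - b) ∈ P) with h | h
    · exact h
    · rw [show 1 + b = 2 - (1 - b) by ring]; exact P.sub_mem h2 h
  have hb' : 1 - b ∈ P := by
    rw [show 1 - b = 2 - (1 + b) by ring]; exact P.sub_mem h2 hb
  have hall : ¬ (e0 ∈ P ∧ e1 ∈ P ∧ e2 ∈ P) := by
    rintro ⟨h0, h1, h2⟩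
    apply hP.ne_top
    rw [Ideal.eq_top_iff_one, ← neg_mem_iff, ← H.sum]
    exact P.add_mem (P.add_mem h0 h1) h2
  have hor : e0 ∈ P ∨ e1 ∈ P := by
    apply hP.mem_or_mem
    rw [H.m01, show 4 * e0 + 2 * e1 + 4 * e2 = (2 * e0 + e1 + 2 * e2) * 2 by ring]
    exact P.mul_mem_left _ h2
  have hd1 : ¬ ∀ x ∈ P, s x ∈ P := by
    intro hx
    have k0 := hx e0
    have k1 := hx e1
    have k2 := hx e2
    rw [H.s0] at k0
    rw [H.s1] at k1
    rw [H.s2] at k2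
    tauto
  have hd2 : ¬ ∀ x ∈ P, (s ^ 2) x ∈ P := by
    intro hx
    have hx' : ∀ x ∈ P, s (s x) ∈ P := hx
    have k0 := hx' e0
    have k1 := hx' e1
    have k2 := hx' e2
    rw [H.s0, H.s1] at k0
    rw [H.s1, H.s2] at k1
    rw [H.s2, H.s0] at k2
    tauto
  refine ⟨1 + b, sh_D1 H hP hP0 Nat.prime_two ?_ hb ?_ ?_ hd1 hd2⟩
  · change (1 + b) * s (s (s (1 + b))) = _
    rw [s1b, s2b, s1b, hmul]; simp
  · rw [s1b]; exact hb'
  · change s (s (1 + b)) ∈ P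
    rw [s1b, s2b]; exact hb

end


lemma sh_three_dvd (p : ℕ) [Fact p.Prime] (k : Type*) [Field k] [Finite k] [CharP k p] (f : ℕ)
    (hcard : Nat.card k = p ^ f) (e : k) (he : e ^ 3 + e ^ 2 - 10 * e - 8 = 0)
    (hno : ∀ a : ZMod p, a ^ 3 + a ^ 2 - 10 * a - 8 ≠ 0) : 3 ∣ f := by
  letI : Algebra (ZMod p) k := ZMod.algebra k p
  let g : Polynomial (ZMod p) := Polynomial.X ^ 3 + Polynomial.X ^ 2 -
    Polynomial.C 10 * Polynomial.X - Polynomial.C 8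
  have hmon : g.Monic := by unfold g; monicity!
  have hdeg : g.natDegree = 3 := by unfold g; compute_degree!
  have hirr : Irreducible g := by
    apply Polynomial.irreducible_of_degree_le_three_of_not_isRoot
    · rw [hdeg]; simp
    · intro a ha
      apply hno a
      simpa [g, Polynomial.IsRoot] using ha
  have hroot : Polynomial.aeval e g = 0 := by
    have h10 : algebraMap (ZMod p) k 10 = 10 := map_ofNat _ 10
    have h8 : algebraMap (ZMod p) k 8 = 8 := map_ofNat _ 8
    simp only [g, map_sub, map_add, map_mul, map_pow, Polynomial.aeval_X, Polynomial.aeval_C, h10, h8]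
    exact he
  have hmin := minpoly.eq_of_irreducible_of_monic hirr hroot hmon
  have hintg : IsIntegral (ZMod p) e := ⟨g, hmon, by simpa [Polynomial.aeval_def] using hroot⟩
  have hd := minpoly.degree_dvd hintg
  rw [← hmin, hdeg] at hd
  have hc := Module.natCard_eq_pow_finrank (K := ZMod p) (V := k)
  rw [hcard, Nat.card_zmod] at hc
  rwa [Nat.pow_right_injective (Fact.out : p.Prime).two_le hc]

lemma sh_list : ∀ p < 251, 17 ≤ p → (∃ a < p, (a ^ 3 + a ^ 2) % p = (10 * a + 8) % p) →
    (∃ c < p, (c ^ 2 + 1) % p = 0) → p.Prime →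
    p = 29 ∨ p = 61 ∨ p = 89 ∨ p = 97 ∨ p = 101 ∨ p = 109 ∨ p = 157 ∨ p = 233 := by
  have : ∀ p ∈ Finset.range 251, 17 ≤ p →
    (∀ d ∈ Finset.range 16, 2 ≤ d → p % d ≠ 0) → (∃ c ∈ Finset.range p, (c ^ 2 + 1) % p = 0) →
    (∃ a ∈ Finset.range p, (a ^ 3 + a ^ 2) % p = (10 * a + 8) % p) →
    p = 29 ∨ p = 61 ∨ p = 89 ∨ p = 97 ∨ p = 101 ∨ p = 109 ∨ p = 157 ∨ p = 233 := by
    decide +kernel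
  simp only [Finset.mem_range] at this
  intro p h1 h2 h3 h4 h5
  refine this p h1 h2 ?_ h4 h3
  intro d hd h2d h0
  rcases (Nat.dvd_prime h5).mp (Nat.dvd_of_mod_eq_zero h0) with h | h <;> omega

section
variable {K : Type*} [Field K] [NumberField K] [IsGalois ℚ K] {σ : K ≃ₐ[ℚ] K}
  {s : 𝓞 K ≃ₐ[ℤ] 𝓞 K} {b e0 e1 e2 : 𝓞 K}

lemma sh_cubic (H : ShSetup K σ s b e0 e1 e2) : e0 ^ 3 + e0 ^ 2 - 10 * e0 - 8 = 0 := by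
  have hsum := H.sum
  have m00 := H.m00
  have m01 := H.m01
  have m02 := H.m02
  grind

lemma sh_residue {P : Ideal (𝓞 K)} {p : ℕ} (hp : p.Prime) (hpP : (p : 𝓞 K) ∈ P)
    (hN : Ideal.absNorm P = p) (x : 𝓞 K) : ∃ a < p, x - (a : 𝓞 K) ∈ P := by
  have hc : Nat.card (𝓞 K ⧸ P) = p := by
    rw [← hN, Ideal.absNorm_apply, Submodule.cardQuot_apply]
  haveI : Finite (𝓞 K ⧸ P) := Nat.finite_of_card_ne_zero (by rw [hc]; exact hp.ne_zero)
  haveI : Fintype (𝓞 K ⧸ P) := Fintype.ofFinite _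
  haveI : NeZero p := ⟨hp.ne_zero⟩
  haveI : Fact p.Prime := ⟨hp⟩
  haveI : Nontrivial (𝓞 K ⧸ P) := Finite.one_lt_card_iff_nontrivial.mp (by rw [hc]; exact hp.one_lt)
  haveI : CharP (𝓞 K ⧸ P) p := by
    apply ringChar.of_eq
    apply CharP.ringChar_of_prime_eq_zero hp
    rw [← map_natCast (Ideal.Quotient.mk P), Ideal.Quotient.eq_zero_iff_mem]; exact hpP
  have hbij : Function.Bijective (ZMod.castHom (dvd_refl p) (𝓞 K ⧸ P)) := by
    rw [Fintype.bijective_iff_injective_and_card]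
    refine ⟨ZMod.castHom_injective _, ?_⟩
    rw [ZMod.card, ← Nat.card_eq_fintype_card, hc]
  obtain ⟨a, ha⟩ := hbij.2 (Ideal.Quotient.mk P x)
  refine ⟨a.val, ZMod.val_lt a, ?_⟩
  rw [← Ideal.Quotient.eq_zero_iff_mem, map_sub, ← ha, map_natCast]
  simp

lemma sh_natmem {P : Ideal (𝓞 K)} (hP : P.IsPrime) {p : ℕ} (hp : p.Prime) (hpP : (p : 𝓞 K) ∈ P)
    (n : ℤ) (h : (n : 𝓞 K) ∈ P) : (p : ℤ) ∣ n := by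
  by_contra hn
  have hc : IsCoprime (p : ℤ) n := by
    rw [Int.isCoprime_iff_gcd_eq_one]
    exact (Nat.Prime.coprime_iff_not_dvd hp).mpr (fun h => hn (Int.natCast_dvd.mpr h))
  obtain ⟨u, v, huv⟩ := hc
  apply hP.ne_top
  rw [Ideal.eq_top_iff_one]
  have h4 : (1 : 𝓞 K) = (u : 𝓞 K) * (p : 𝓞 K) + v * (n : 𝓞 K) := by
    have := congrArg (Int.cast : ℤ → 𝓞 K) huv
    push_cast at this ⊢
    exact this.symm
  rw [h4]
  exact P.add_mem (P.mul_mem_left _ hpP) (P.mul_mem_left _ h)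

lemma sh_three_dvd_prime (H : ShSetup K σ s b e0 e1 e2) {P : Ideal (𝓞 K)} (hP : P.IsPrime)
    (hP0 : P ≠ ⊥) {p f : ℕ} (hp : p.Prime) (hpP : (p : 𝓞 K) ∈ P) (hN : Ideal.absNorm P = p ^ f)
    (hno : ∀ a : ZMod p, a ^ 3 + a ^ 2 - 10 * a - 8 ≠ 0) : 3 ∣ f := by
  haveI : P.IsMaximal := hP.isMaximal hP0
  letI : Field (𝓞 K ⧸ P) := Ideal.Quotient.field P
  have hc : Nat.card (𝓞 K ⧸ P) = p ^ f := by
    rw [← hN, Ideal.absNorm_apply, Submodule.cardQuot_apply]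
  haveI : Finite (𝓞 K ⧸ P) := Nat.finite_of_card_ne_zero (by
    rw [hc]; exact pow_ne_zero _ hp.ne_zero)
  haveI : Fact p.Prime := ⟨hp⟩
  haveI : CharP (𝓞 K ⧸ P) p := by
    apply ringChar.of_eq
    apply CharP.ringChar_of_prime_eq_zero hp
    rw [← map_natCast (Ideal.Quotient.mk P), Ideal.Quotient.eq_zero_iff_mem]; exact hpP
  refine sh_three_dvd p (𝓞 K ⧸ P) f hc (Ideal.Quotient.mk P e0) ?_ hno
  have := congrArg (Ideal.Quotient.mk P) (sh_cubic H)
  have h10 : Ideal.Quotient.mk P 10 = 10 := map_ofNat _ 10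
  have h8 : Ideal.Quotient.mk P 8 = 8 := map_ofNat _ 8
  simpa [h10, h8] using this

lemma sh_prime (H : ShSetup K σ s b e0 e1 e2) (P : Ideal (𝓞 K)) (hP : P.IsPrime)
    (hP0 : P ≠ ⊥) (hle : Ideal.absNorm P ≤ 250) : ∃ μ, ShT s P μ := by
  haveI hM : P.IsMaximal := hP.isMaximal hP0
  obtain ⟨p, f, hf, hpP, hp, hN⟩ := Ideal.exists_prime_and_absNorm_eq_pow P
  have hp2 := hp.two_le
  have hbig : ∀ k, k ≤ f → p ^ k ≤ 250 := fun k hk => by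
    rw [hN] at hle
    exact (Nat.pow_le_pow_right hp.pos hk).trans hle
  have hsum := H.sum
  have m00 := H.m00
  have m01 := H.m01
  have m02 := H.m02
  have m11 := H.m11
  have m12 := H.m12
  have m22 := H.m22
  have hD := sh_D2 H hP hP0 hp hpP
  by_cases h17 : 17 ≤ p
  · have hf1 : f = 1 := by
      by_contra hne
      have := hbig 2 (by omega)
      nlinarith
    rw [hf1, pow_one] at hN
    obtain ⟨a, ha, hae⟩ := sh_residue hp hpP hN e0
    obtain ⟨c, hc, hcb⟩ := sh_residue hp hpP hN b
    have k1 : (p : ℤ) ∣ (c : ℤ) ^ 2 + 1 := by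
      apply sh_natmem hP hp hpP
      have : (((c : ℤ) ^ 2 + 1 : ℤ) : 𝓞 K) = -(b + c) * (b - c) := by
        push_cast; linear_combination H.bb
      rw [this]
      exact P.mul_mem_left _ hcb
    have k2 : (p : ℤ) ∣ ((a : ℤ) ^ 3 + (a : ℤ) ^ 2) - (10 * a + 8) := by
      apply sh_natmem hP hp hpP
      have : ((((a : ℤ) ^ 3 + (a : ℤ) ^ 2) - (10 * a + 8) : ℤ) : 𝓞 K) =
          -(e0 ^ 2 + e0 * a + a ^ 2 + e0 + a - 10) * (e0 - a) := by
        push_cast; linear_combination sh_cubic H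
      rw [this]
      exact P.mul_mem_left _ hae
    have hl := sh_list p (by omega) h17 ⟨a, ha, by
      have := Int.emod_eq_emod_iff_emod_sub_eq_zero.mpr (Int.emod_eq_zero_of_dvd k2)
      exact_mod_cast this⟩ ⟨c, hc, Nat.mod_eq_zero_of_dvd (by exact_mod_cast k1)⟩ hp
    rcases hl with rfl | rfl | rfl | rfl | rfl | rfl | rfl | rfl
    · exact hD (-2) (-1) 0 (-1) 0 (-1) (by push_cast; grind) (by norm_num)
    · exact hD (-4) (-2) (-1) (-1) (-1) 0 (by push_cast; grind) (by norm_num)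
    · exact hD (-5) (-3) (-2) (-2) (-4) (-3) (by push_cast; grind) (by norm_num)
    · exact hD (-2) (-1) 1 (-1) 2 0 (by push_cast; grind) (by norm_num)
    · exact hD (-6) (-5) (-4) (-1) (-4) (-3) (by push_cast; grind) (by norm_num)
    · exact hD (-8) (-7) (-7) (-1) 0 2 (by push_cast; grind) (by norm_num)
    · exact hD (-7) (-4) (-2) 0 (-1) (-1) (by push_cast; grind) (by norm_num)
    · exact hD (-12) (-11) (-10) (-1) 2 3 (by push_cast; grind) (by norm_num)
  · have hcases : p = 2 ∨ p = 3 ∨ p = 5 ∨ p = 7 ∨ p = 11 ∨ p = 13 := by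
      interval_cases p <;> first | omega | (exfalso; revert hp; norm_num)
    have h3 := sh_three_dvd_prime H hP hP0 hp hpP hN
    rcases hcases with rfl | rfl | rfl | rfl | rfl | rfl
    · exact sh_D_two H hP hP0 hpP
    · exfalso
      have hd := h3 (by decide)
      have hf3 : f = 3 := by
        by_contra hne
        have := hbig 6 (by omega)
        norm_num at this
      rw [hf3] at hN
      letI : Field (𝓞 K ⧸ P) := Ideal.Quotient.field P
      have hc : Nat.card (𝓞 K ⧸ P) = 27 := by
        rw [← Submodule.cardQuot_apply, ← Ideal.absNorm_apply, hN]; norm_num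
      haveI : Finite (𝓞 K ⧸ P) := Nat.finite_of_card_ne_zero (by rw [hc]; norm_num)
      haveI : Fintype (𝓞 K ⧸ P) := Fintype.ofFinite _
      have hbq : (Ideal.Quotient.mk P b) * (Ideal.Quotient.mk P b) = -1 := by
        rw [← map_mul, H.bb]; simp
      have hb0 : Ideal.Quotient.mk P b ≠ 0 := by
        intro h; rw [h] at hbq; simp at hbq
      have h26 := FiniteField.pow_card_sub_one_eq_one _ hb0
      rw [← Nat.card_eq_fintype_card, hc, show 27 - 1 = 2 * 13 by norm_num, pow_mul, pow_two, hbq] at h26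
      have h2 : Ideal.Quotient.mk P ((2 : ℤ) : 𝓞 K) = 0 := by
        rw [map_intCast]; push_cast
        linear_combination -h26
      rw [Ideal.Quotient.eq_zero_iff_mem] at h2
      have := sh_natmem hP hp hpP _ h2
      norm_num at this
    · have hd := h3 (by decide)
      have hf3 : f = 3 := by
        by_contra hne
        have := hbig 6 (by omega)
        norm_num at this
      rw [hf3] at hN
      have key : ∀ z : 𝓞 K, z ∈ P → z * (s ^ 3) z = ((5 : ℕ) : 𝓞 K) → ∃ μ, ShT s P μ := by
        intro z hz h5
        have hzN := sh_absNorm_cube H h5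
        obtain ⟨Z, hZ⟩ := Ideal.dvd_span_singleton.mpr hz
        have h1 := congrArg Ideal.absNorm hZ
        rw [map_mul, hzN, hN] at h1
        have hZ1 : Ideal.absNorm Z = 1 := by omega
        rw [Ideal.absNorm_eq_one_iff] at hZ1
        rw [hZ1, Ideal.mul_top] at hZ
        rw [← hZ]
        exact ⟨_, sh_T_principal H z⟩
      have t2 : (s ^ 3) (2 : 𝓞 K) = 2 := map_ofNat _ 2
      have hbs : (s ^ 3) b = -b := by
        change s (s (s b)) = -b
        rw [H.sb, map_neg, H.sb, neg_neg, H.sb]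
      have hmul : (2 + b) * (2 - b) = ((5 : ℕ) : 𝓞 K) := by
        push_cast; linear_combination -H.bb
      rcases hP.mem_or_mem (hmul ▸ hpP : (2 + b) * (2 - b) ∈ P) with h | h
      · exact key _ h (by rw [map_add, t2, hbs, ← hmul]; ring)
      · exact key _ h (by rw [map_sub, t2, hbs, ← hmul]; ring)
    all_goals
      exfalso
      have hd := h3 (by decide)
      have := hbig 3 (Nat.le_of_dvd hf hd)
      norm_num at this

end

section
variable {K : Type*} [Field K] [NumberField K] [IsGalois ℚ K]
  {σ : K ≃ₐ[ℚ] K} {s : 𝓞 K ≃ₐ[ℤ] 𝓞 K} {b e0 e1 e2 : 𝓞 K}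

/-- The normalised generator attached to an ideal. -/
def ShG {K : Type*} [Field K] [NumberField K] (s : 𝓞 K ≃ₐ[ℤ] 𝓞 K) (b : 𝓞 K) (I : Ideal (𝓞 K))
    (μ : 𝓞 K) : Prop := ShT s I μ ∧ ShPr b (ShNm s μ)

lemma sh_map_map (t u : 𝓞 K ≃ₐ[ℤ] 𝓞 K) (I : Ideal (𝓞 K)) :
    Ideal.map t (Ideal.map u I) = Ideal.map (t * u) I := by
  rw [show Ideal.map u I = Ideal.span (Set.image u I) from rfl, Ideal.map_span, Set.image_image]
  rfl

lemma sh_map_ne (t : 𝓞 K ≃ₐ[ℤ] 𝓞 K) {I : Ideal (𝓞 K)} (hI : I ≠ ⊥) : Ideal.map t I ≠ ⊥ := by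
  intro h
  apply hI
  rw [← Ideal.absNorm_eq_zero_iff, ← sh_absNorm_map t, h, Ideal.absNorm_bot]

lemma sh_G_s (H : ShSetup K σ s b e0 e1 e2) {I : Ideal (𝓞 K)} {μ : 𝓞 K} (h : ShG s b I μ) :
    ShG s b (Ideal.map s I) (s μ) := by
  have c : ∀ n, ∀ y, (s ^ n) (s y) = s ((s ^ n) y) := by
    intro n y
    rw [← AlgEquiv.mul_apply, ← AlgEquiv.mul_apply, ← pow_succ, ← pow_succ']
  refine ⟨⟨?_, ?_⟩, ?_⟩
  · rw [← sh_map_span, h.1.1, Ideal.map_mul, Ideal.map_mul, sh_map_map, sh_map_map, sh_map_map,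
      sh_map_map, ← pow_succ, ← pow_succ', ← pow_succ, ← pow_succ']
  · rw [c, ← map_mul, h.1.2, sh_absNorm_map, map_natCast]
  · have : ShNm s (s μ) = s (ShNm s μ) := by
      simp only [ShNm, c, map_mul]
    rw [this]
    exact sh_pr_s H h.2

lemma sh_G_s3 (H : ShSetup K σ s b e0 e1 e2) {I : Ideal (𝓞 K)} {μ : 𝓞 K} (h : ShG s b I μ) :
    ShG s b (Ideal.map (s ^ 3) I) ((s ^ 3) μ) := by
  have := sh_G_s H (sh_G_s H (sh_G_s H h))
  rw [sh_map_map, sh_map_map] at this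
  exact this

lemma sh_G_mul (H : ShSetup K σ s b e0 e1 e2) {I J : Ideal (𝓞 K)} {μ ν : 𝓞 K} (h : ShG s b I μ)
    (h' : ShG s b J ν) : ShG s b (I * J) (μ * ν) :=
  ⟨sh_T_mul h.1 h'.1, by rw [sh_nm_mul]; exact sh_pr_mul H h.2 h'.2⟩

lemma sh_two_not (H : ShSetup K σ s b e0 e1 e2) {I P : Ideal (𝓞 K)} (hP : P.IsPrime) (hIP : I ≤ P)
    (hc : IsCoprime I (Ideal.span {(4 : 𝓞 K)})) : (2 : 𝓞 K) ∉ P := by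
  intro h2
  apply hP.ne_top
  rw [eq_top_iff, ← Ideal.isCoprime_iff_sup_eq.mp hc]
  refine sup_le hIP ?_
  rw [Ideal.span_singleton_le_iff_mem, show (4 : 𝓞 K) = 2 * 2 by norm_num]
  exact P.mul_mem_left _ h2

lemma sh_odd (H : ShSetup K σ s b e0 e1 e2) {I : Ideal (𝓞 K)} 
    (hc : IsCoprime I (Ideal.span {(4 : 𝓞 K)})) : Ideal.absNorm I % 2 = 1 := by
  by_contra h
  have h2 : 2 ∣ Ideal.absNorm I := by omega
  obtain ⟨P, hP, h3, h4⟩ := Ideal.exists_isMaximal_dvd_of_dvd_absNorm' Nat.prime_two I h2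
  refine sh_two_not H hP.isPrime (Ideal.le_of_dvd h4) hc ?_
  have : (2 : ℤ) ∈ Ideal.under ℤ P := by
    rw [h3]; exact Ideal.mem_span_singleton_self _
  simpa [Ideal.mem_comap] using this

lemma sh_G_ex (H : ShSetup K σ s b e0 e1 e2) {I : Ideal (𝓞 K)} (hI : I ≠ ⊥)
    (hc : IsCoprime I (Ideal.span {(4 : 𝓞 K)})) : ∃ μ, ShG s b I μ := by
  obtain ⟨μ, hμ⟩ := sh_reduce H (sh_prime H) I hI
  exact sh_T_primary H (sh_odd H hc) hμ

lemma sh_G_one (H : ShSetup K σ s b e0 e1 e2) (x : 𝓞 K) (hx : x - 1 ∈ Ideal.span {(4 : 𝓞 K)}) :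
    ShG s b (Ideal.span {x}) (x * (s ^ 4) x * (s ^ 5) x) := by
  refine ⟨sh_T_principal H x, ?_⟩
  set z := x * (s ^ 4) x * (s ^ 5) x with hz
  let q := Ideal.Quotient.mk (Ideal.span {(4 : 𝓞 K)})
  have hs : ∀ n, ∀ y, q y = 1 → q ((s ^ n) y) = 1 := by
    intro n y hy
    have h1 : y - 1 ∈ Ideal.span {(4 : 𝓞 K)} := by
      rw [← Ideal.Quotient.eq]; exact hy
    obtain ⟨w, hw⟩ := Ideal.mem_span_singleton'.mp h1
    have : (s ^ n) y - 1 ∈ Ideal.span {(4 : 𝓞 K)} := by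
      refine Ideal.mem_span_singleton'.mpr ⟨(s ^ n) w, ?_⟩
      have h4 : (s ^ n) (4 : 𝓞 K) = 4 := map_ofNat _ 4
      have := congrArg (s ^ n) hw
      rwa [map_mul, h4, map_sub, map_one] at this
    exact (Ideal.Quotient.eq).mpr this
  have hx1 : q x = 1 := (Ideal.Quotient.eq).mpr hx
  have hz1 : q z = 1 := by rw [hz, map_mul, map_mul, hs _ _ hx1, hs _ _ hx1, hx1]; simp
  have hn1 : q (ShNm s z) = 1 := by
    rw [ShNm, map_mul, map_mul, hs _ _ hz1, hs _ _ hz1, hz1]; simp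
  have h1 : ShNm s z - 1 ∈ Ideal.span {(4 : 𝓞 K)} := by
    rw [← Ideal.Quotient.eq]; exact hn1
  obtain ⟨w, hw⟩ := Ideal.mem_span_singleton'.mp h1
  have hfix : s (s (ShNm s z)) = ShNm s z := by
    change s (s (z * s (s z) * s (s (s (s z))))) = z * s (s z) * s (s (s (s z)))
    simp only [map_mul, H.s6]; ring
  have h4 : s (4 : 𝓞 K) = 4 := map_ofNat _ 4
  have hw2 : s (s w) = w := by
    have h5 := congrArg (fun y => s (s y)) hw
    simp only [map_mul, map_sub, map_one, h4, hfix] at h5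
    have h6 := h5.trans hw.symm
    exact mul_right_cancel₀ (by norm_num) h6
  obtain ⟨m, n, hmn⟩ := H.fix2 w hw2
  refine ⟨4 * m + 1, 4 * n, ?_, by omega, by omega⟩
  push_cast
  rw [hmn] at hw
  linear_combination -hw

lemma sh_pr_int (H : ShSetup K σ s b e0 e1 e2) (k : ℤ) (h : ShPr b (k : 𝓞 K)) : k % 4 = 1 := by
  obtain ⟨m, n, h1, h2, h3⟩ := h
  have := sh_mn H (m := k) (n := 0) (m' := m) (n' := n) (by simpa using h1)
  omega

end

section
variable {K : Type*} [Field K] [NumberField K] [IsGalois ℚ K]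
  {σ : K ≃ₐ[ℚ] K} {s : 𝓞 K ≃ₐ[ℤ] 𝓞 K} {b e0 e1 e2 : 𝓞 K}

lemma sh_card {L : Type*} [Field L] [NumberField L] (I : Ideal (𝓞 L)) :
    Nat.card (𝓞 L ⧸ I) = Ideal.absNorm I := by
  rw [Ideal.absNorm_apply, Submodule.cardQuot_apply]

lemma sh_alg_fix (H : ShSetup K σ s b e0 e1 e2) (x : 𝓞 (cubicFixedField σ)) :
    (s ^ 3) (algebraMap (𝓞 (cubicFixedField σ)) (𝓞 K) x) = algebraMap _ (𝓞 K) x := by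
  apply RingOfIntegers.ext
  rw [sh_pows H]
  have h1 : ((algebraMap (𝓞 (cubicFixedField σ)) (𝓞 K) x : 𝓞 K) : K)
    = ((x : cubicFixedField σ) : K) := rfl
  rw [h1]
  exact (x : cubicFixedField σ).2 ⟨σ ^ 3, Subgroup.mem_zpowers _⟩

lemma sh_map_fix (H : ShSetup K σ s b e0 e1 e2) (𝔭 : Ideal (𝓞 (cubicFixedField σ))) :
    Ideal.map (s ^ 3) (Ideal.map (algebraMap (𝓞 (cubicFixedField σ)) (𝓞 K)) 𝔭) =
      Ideal.map (algebraMap (𝓞 (cubicFixedField σ)) (𝓞 K)) 𝔭 := by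
  rw [show Ideal.map (algebraMap (𝓞 (cubicFixedField σ)) (𝓞 K)) 𝔭 =
    Ideal.span (Set.image (algebraMap (𝓞 (cubicFixedField σ)) (𝓞 K)) 𝔭) from rfl, Ideal.map_span,
    Set.image_image]
  simp only [sh_alg_fix H]

lemma sh_norm_sq (H : ShSetup K σ s b e0 e1 e2) (𝔭 : Ideal (𝓞 (cubicFixedField σ))) :
    Ideal.absNorm (Ideal.map (algebraMap (𝓞 (cubicFixedField σ)) (𝓞 K)) 𝔭) =
      Ideal.absNorm 𝔭 ^ 2 := by
  rw [Ideal.absNorm_algebraMap,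
    ← IsFractionRing.finrank_eq (𝓞 (cubicFixedField σ)) (cubicFixedField σ) (𝓞 K) K]
  congr 1
  rw [cubicFixedField, IntermediateField.finrank_fixedField_eq_card, Nat.card_zpowers,
    orderOf_pow, H.ord]
  norm_num

lemma sh_bot (𝔭 : Ideal (𝓞 (cubicFixedField σ))) (h : 𝔭 ≠ ⊥) :
    Ideal.map (algebraMap (𝓞 (cubicFixedField σ)) (𝓞 K)) 𝔭 ≠ ⊥ := by
  rwa [Ne, Ideal.map_eq_bot_iff_of_injective]
  exact FaithfulSMul.algebraMap_injective _ _

/-- A finite residue field of odd order contains a square root of `-1` iff its order is 1 mod 4. -/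
lemma sh_neg_one {L : Type*} [Field L] [NumberField L] (P : Ideal (𝓞 L)) (hP : P.IsPrime)
    (hP0 : P ≠ ⊥) : (∃ c : 𝓞 L, c * c + 1 ∈ P) ↔ Ideal.absNorm P % 4 ≠ 3 := by
  haveI : P.IsMaximal := hP.isMaximal hP0
  letI : Field (𝓞 L ⧸ P) := Ideal.Quotient.field P
  haveI : Finite (𝓞 L ⧸ P) := inferInstance
  letI : Fintype (𝓞 L ⧸ P) := Fintype.ofFinite _
  rw [← sh_card, Nat.card_eq_fintype_card, ← FiniteField.isSquare_neg_one_iff]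
  constructor
  · rintro ⟨c, hc⟩
    refine ⟨Ideal.Quotient.mk P c, ?_⟩
    rw [← Ideal.Quotient.eq_zero_iff_mem, map_add, map_mul, map_one] at hc
    linear_combination -hc
  · rintro ⟨c, hc⟩
    obtain ⟨c, rfl⟩ := Ideal.Quotient.mk_surjective c
    refine ⟨c, ?_⟩
    rw [← Ideal.Quotient.eq_zero_iff_mem, map_add, map_mul, map_one]
    linear_combination -hc

lemma sh_dvd (𝔭 : Ideal (𝓞 (cubicFixedField σ))) (hp : 𝔭.IsPrime) (h0 : 𝔭 ≠ ⊥)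
    (Q : Ideal (𝓞 K)) (hQ : Q.IsPrime)
    (h : Ideal.map (algebraMap (𝓞 (cubicFixedField σ)) (𝓞 K)) 𝔭 ≤ Q) :
    Ideal.absNorm 𝔭 ∣ Ideal.absNorm Q := by
  have hm : 𝔭.IsMaximal := hp.isMaximal h0
  have hc : 𝔭 = Ideal.comap (algebraMap (𝓞 (cubicFixedField σ)) (𝓞 K)) Q :=
    hm.eq_of_le (Ideal.comap_ne_top _ hQ.ne_top) (Ideal.map_le_iff_le_comap.mp h)
  rw [← sh_card, ← sh_card]
  let f := Ideal.quotientMap (I := 𝔭) Q (algebraMap (𝓞 (cubicFixedField σ)) (𝓞 K)) hc.le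
  have hf : Function.Injective f := Ideal.quotientMap_injective' hc.ge
  exact AddSubgroup.card_dvd_of_injective f.toAddMonoidHom hf

lemma sh_val (H : ShSetup K σ s b e0 e1 e2) (𝔭 : Ideal (𝓞 (cubicFixedField σ))) (h0 : 𝔭 ≠ ⊥)
    (hodd : Ideal.absNorm 𝔭 % 2 = 1)
    {μ : 𝓞 K} (h : ShG s b (Ideal.map (algebraMap (𝓞 (cubicFixedField σ)) (𝓞 K)) 𝔭) μ) :
    (Ideal.absNorm 𝔭 % 4 = 1 → μ = (Ideal.absNorm 𝔭 : 𝓞 K)) ∧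
    (Ideal.absNorm 𝔭 % 4 = 3 → μ = -(Ideal.absNorm 𝔭 : 𝓞 K)) := by
  have h3 := sh_G_s3 H h
  rw [sh_map_fix H] at h3
  have e := sh_T_unique H (sh_bot 𝔭 h0) h3.1 h.1 h3.2 h.2
  have hn := h.1.2
  rw [e, sh_norm_sq H] at hn
  generalize Ideal.absNorm 𝔭 = q at *
  have hsq : (μ - q) * (μ + q) = 0 := by push_cast at hn; linear_combination hn
  have hq : ShNm s (q : 𝓞 K) = ((q ^ 3 : ℤ) : 𝓞 K) := by
    simp only [ShNm, map_natCast]; push_cast; ring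
  have hmod : ∀ r : ℤ, (q : ℤ) % 4 = r → (q : ℤ) ^ 3 % 4 = r ^ 3 % 4 := by
    intro r hr
    rw [← hr]; exact (Int.ModEq.pow 3 (Int.mod_modEq _ _)).symm
  rcases mul_eq_zero.mp hsq with h1 | h1
  · have h2 : μ = q := sub_eq_zero.mp h1
    refine ⟨fun _ => h2, fun hr => ?_⟩
    have h4 := h.2
    rw [h2, hq] at h4
    have h5 := sh_pr_int H _ h4
    have h6 := hmod 3 (by omega)
    norm_num at h6
    omega
  · have h2 : μ = -q := eq_neg_of_add_eq_zero_left h1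
    refine ⟨fun hr => ?_, fun _ => h2⟩
    have h4 := h.2
    rw [h2, sh_nm_neg, hq, ← Int.cast_neg] at h4
    have h5 := sh_pr_int H _ h4
    have h6 := hmod 1 (by omega)
    norm_num at h6
    omega

lemma sh_oddp (H : ShSetup K σ s b e0 e1 e2) (𝔭 : Ideal (𝓞 (cubicFixedField σ)))
    (hc : IsCoprime (Ideal.map (algebraMap (𝓞 (cubicFixedField σ)) (𝓞 K)) 𝔭)
      (Ideal.span {(4 : 𝓞 K)})) : Ideal.absNorm 𝔭 % 2 = 1 := by
  have h := sh_odd H hc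
  rw [sh_norm_sq H] at h
  by_contra h2
  have h3 : 2 ∣ Ideal.absNorm 𝔭 := by omega
  have h4 : 2 ∣ Ideal.absNorm 𝔭 ^ 2 := dvd_pow h3 (by norm_num)
  omega

lemma sh_split (H : ShSetup K σ s b e0 e1 e2) (𝔭 : Ideal (𝓞 (cubicFixedField σ)))
    (hp : 𝔭.IsPrime) (h0 : 𝔭 ≠ ⊥)
    (hc : IsCoprime (Ideal.map (algebraMap (𝓞 (cubicFixedField σ)) (𝓞 K)) 𝔭)
      (Ideal.span {(4 : 𝓞 K)})) (Q₁ Q₂ : Ideal (𝓞 K)) (h1 : Q₁.IsPrime) (h2 : Q₂.IsPrime)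
    (h : Ideal.map (algebraMap (𝓞 (cubicFixedField σ)) (𝓞 K)) 𝔭 = Q₁ * Q₂) :
    Ideal.absNorm 𝔭 % 4 = 1 := by
  have hb := sh_bot 𝔭 h0
  have hQ1 : Q₁ ≠ ⊥ := by
    rintro rfl
    rw [Ideal.bot_mul] at h
    exact hb h
  have hn := sh_norm_sq H 𝔭
  rw [h, map_mul] at hn
  obtain ⟨x, hx⟩ := sh_dvd 𝔭 hp h0 Q₁ h1 (h.le.trans Ideal.mul_le_left)
  obtain ⟨y, hy⟩ := sh_dvd 𝔭 hp h0 Q₂ h2 (h.le.trans Ideal.mul_le_right)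
  have hq : 0 < Ideal.absNorm 𝔭 := by
    have := sh_oddp H 𝔭 hc
    omega
  have hxy : x * y = 1 := by
    rw [hx, hy] at hn
    have : Ideal.absNorm 𝔭 ^ 2 * (x * y) = Ideal.absNorm 𝔭 ^ 2 * 1 := by linarith
    exact Nat.eq_of_mul_eq_mul_left (by positivity) this
  have hx1 : x = 1 := Nat.eq_one_of_mul_eq_one_right hxy
  rw [hx1, mul_one] at hx
  have h4 := (sh_neg_one Q₁ h1 hQ1).mp ⟨b, by rw [H.bb]; simp⟩
  rw [hx] at h4
  have := sh_oddp H 𝔭 hc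
  omega

lemma sh_inert (H : ShSetup K σ s b e0 e1 e2) (𝔭 : Ideal (𝓞 (cubicFixedField σ)))
    (hp : 𝔭.IsPrime) (h0 : 𝔭 ≠ ⊥)
    (hc : IsCoprime (Ideal.map (algebraMap (𝓞 (cubicFixedField σ)) (𝓞 K)) 𝔭)
      (Ideal.span {(4 : 𝓞 K)}))
    (h : (Ideal.map (algebraMap (𝓞 (cubicFixedField σ)) (𝓞 K)) 𝔭).IsPrime) :
    Ideal.absNorm 𝔭 % 4 = 3 := by
  by_contra h3
  obtain ⟨c, hcc⟩ := (sh_neg_one 𝔭 hp h0).mpr h3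
  have h4 := Ideal.mem_map_of_mem (algebraMap (𝓞 (cubicFixedField σ)) (𝓞 K)) hcc
  have hfix := sh_alg_fix H c
  have hst : ∀ x ∈ Ideal.map (algebraMap (𝓞 (cubicFixedField σ)) (𝓞 K)) 𝔭,
      (s ^ 3) x ∈ Ideal.map (algebraMap (𝓞 (cubicFixedField σ)) (𝓞 K)) 𝔭 := by
    intro x hx
    have := Ideal.mem_map_of_mem (s ^ 3) hx
    rwa [sh_map_fix H] at this
  have h2 := sh_two_not H h le_rfl hc
  rw [map_add, map_mul, map_one] at h4
  generalize algebraMap (𝓞 (cubicFixedField σ)) (𝓞 K) c = d at *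
  generalize Ideal.map (algebraMap (𝓞 (cubicFixedField σ)) (𝓞 K)) 𝔭 = I at *
  have h5 : (d - b) * (d + b) ∈ I := by
    rw [show (d - b) * (d + b) = d * d + 1 by linear_combination -H.bb]; exact h4
  have key : (d - b) ∈ I ∧ (d + b) ∈ I := by
    rcases h.mem_or_mem h5 with h6 | h6
    · refine ⟨h6, ?_⟩
      have := hst _ h6
      rwa [map_sub, hfix, sh_s3b H, sub_neg_eq_add] at this
    · refine ⟨?_, h6⟩
      have := hst _ h6
      rwa [map_add, hfix, sh_s3b H, ← sub_eq_add_neg] at this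
  apply h2
  have := I.mul_mem_left (-b) (I.sub_mem key.2 key.1)
  rwa [show -b * ((d + b) - (d - b)) = 2 by linear_combination -2 * H.bb] at this

open Classical in
/-- The character. -/
noncomputable def ShPsi {K : Type*} [Field K] [NumberField K] (s : 𝓞 K ≃ₐ[ℤ] 𝓞 K) (b : 𝓞 K)
    (I : Ideal (𝓞 K)) : K :=
  if h : ∃ μ, ShG s b I μ then ((h.choose : 𝓞 K) : K) else 0

lemma sh_psi (H : ShSetup K σ s b e0 e1 e2) {I : Ideal (𝓞 K)} (hI : I ≠ ⊥) {μ : 𝓞 K}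
    (h : ShG s b I μ) : ShPsi s b I = (μ : K) := by
  have hex : ∃ μ, ShG s b I μ := ⟨μ, h⟩
  rw [ShPsi, dif_pos hex]
  rw [sh_T_unique H hI hex.choose_spec.1 h.1 hex.choose_spec.2 h.2]

lemma sh_main (H : ShSetup K σ (galRestrict ℤ ℚ K (𝓞 K) σ) b e0 e1 e2) :
    IsShimuraIdealChar σ (Ideal.span {(4 : 𝓞 K)}) (ShPsi (galRestrict ℤ ℚ K (𝓞 K) σ) b) := by
  have hconj : ∀ n I, idealConj (σ ^ n) I = Ideal.map ((galRestrict ℤ ℚ K (𝓞 K) σ) ^ n) I := by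
    intro n I
    rw [idealConj, map_pow]
  have hconj1 : ∀ I, idealConj σ I = Ideal.map (galRestrict ℤ ℚ K (𝓞 K) σ) I := fun I => rfl
  generalize galRestrict ℤ ℚ K (𝓞 K) σ = s at *
  refine ⟨?_, ?_, ?_, ?_, ?_, ?_⟩
  · intro I hI hc
    obtain ⟨μ, hμ⟩ := sh_G_ex H hI hc
    rw [sh_psi H hI hμ]
    exact RingOfIntegers.coe_ne_zero_iff.mpr (sh_T_ne hμ.1 hI)
  · intro I J hI hJ hcI hcJ
    obtain ⟨μ, hμ⟩ := sh_G_ex H hI hcI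
    obtain ⟨ν, hν⟩ := sh_G_ex H hJ hcJ
    rw [sh_psi H hI hμ, sh_psi H hJ hν, sh_psi H (mul_ne_zero hI hJ) (sh_G_mul H hμ hν)]
    exact map_mul (algebraMap (𝓞 K) K) _ _
  · intro x hc hx
    have hx0 : Ideal.span {x} ≠ ⊥ := by
      intro h
      have h1 := sh_odd H hc
      rw [h, Ideal.absNorm_bot] at h1
      omega
    rw [sh_psi H hx0 (sh_G_one H x hx), ← sh_pows H, ← sh_pows H]
    exact (map_mul (algebraMap (𝓞 K) K) _ _).trans (by rw [map_mul])
  · intro 𝔭 hp h0 hc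
    obtain ⟨μ, hμ⟩ := sh_G_ex H (sh_bot 𝔭 h0) hc
    rw [sh_psi H (sh_bot 𝔭 h0) hμ, sh_card]
    have hv := sh_val H 𝔭 h0 (sh_oddp H 𝔭 hc) hμ
    constructor
    · rintro ⟨Q₁, Q₂, h1, h2, -, h⟩
      rw [hv.1 (sh_split H 𝔭 hp h0 hc Q₁ Q₂ h1 h2 h)]
      exact map_natCast (algebraMap (𝓞 K) K) _
    · intro h
      rw [hv.2 (sh_inert H 𝔭 hp h0 hc h)]
      exact (map_neg (algebraMap (𝓞 K) K) _).trans (by rw [map_natCast])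
  · intro I hI hc
    obtain ⟨μ, hμ⟩ := sh_G_ex H hI hc
    rw [sh_psi H hI hμ, sh_card, hconj, hconj, ← hμ.1.1, FractionalIdeal.coeIdeal_span_singleton]
    refine ⟨?_, rfl⟩
    rw [← sh_pows H]
    exact (map_mul (algebraMap (𝓞 K) K) _ _).symm.trans (by rw [hμ.1.2, map_natCast])
  · intro I hI hc
    obtain ⟨μ, hμ⟩ := sh_G_ex H hI hc
    rw [hconj1, sh_psi H hI hμ, sh_psi H (sh_map_ne s hI) (sh_G_s H hμ), H.hs]

end

/-- For the sextic cyclic CM field ℚ(α, i) of conductor 124 there exists a Shimura ideal character. -/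
theorem stmt_10 (K : Type*) [Field K] [NumberField K]
    (hdeg : Module.finrank ℚ K = 6) [IsGalois ℚ K] (hcyc : IsCyclic (K ≃ₐ[ℚ] K))
    (α β : K) (hα : α ^ 3 = 93 * α - 124) (hβ : β ^ 2 = (-1 : K)) :
    ∃ (σ : K ≃ₐ[ℚ] K) (𝔠 : Ideal (𝓞 K)) (ψ : Ideal (𝓞 K) → K),
      (∀ τ : K ≃ₐ[ℚ] K, τ ∈ Subgroup.zpowers σ) ∧ 𝔠 ≠ ⊥ ∧
      IsShimuraIdealChar σ 𝔠 ψ := by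
  obtain ⟨σ, b, e0, e1, e2, H⟩ := sh_setup_exists K hdeg hcyc α β hα hβ
  refine ⟨σ, Ideal.span {(4 : 𝓞 K)}, ShPsi (galRestrict ℤ ℚ K (𝓞 K) σ) b, H.gen, ?_, sh_main H⟩
  rw [Ne, Ideal.span_singleton_eq_bot]
  norm_num
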